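/- arXiv:1010.1129 — 6 statements merged into one kernel-verified Lean document; each statement's English description precedes it below -/
import Mathlib

section
/- Let k be a field, R a ℤ-graded k-algebra, M a left R-module, α, β ∈ kˣ, and ψ : M → M a k-linear map which is a homomorphism of R-modules from M_α to M_β, i.e. ψ(σ_α(r) · m) = σ_β(r) · ψ(m) for all r ∈ R and m ∈ M. Then for every d ∈ ℤ, every homogeneous element r ∈ R_d, every λ ∈ k, and every m in the generalized eigenspace M(λ) of ψ, the element r · m lies in the generalized eigenspace M((β/α)^d λ) of ψ. -/
/-- If `f (r • x) = c • r • g x` for all `x`, then `f ^ n` and `g ^ n` satisfy the same relation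
with `c ^ n`. -/
theorem Module.End.pow_smul_eq_of_smul_eq {k R M : Type*} [CommSemiring k] [AddCommMonoid M]
    [Module k M] [SMul R M] {f g : Module.End k M} {c : k} {r : R}
    (h : ∀ x : M, f (r • x) = c • r • g x) (n : ℕ) (x : M) :
    (f ^ n) (r • x) = c ^ n • r • (g ^ n) x := by
  induction n generalizing x with
  | zero => simp
  | succ n ih =>
    rw [pow_succ, pow_succ g, Module.End.mul_apply, Module.End.mul_apply, h, map_smul, ih,
      smul_smul, ← pow_succ']

/-- Setting as in Statement 2: `ψ : M → M` is `k`-linear and is a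
homomorphism of `R`-modules `M_α → M_β`.  Then for every `d : ℤ`, homogeneous `r ∈ 𝒜 d`,
`μ ∈ k` and every `m` in the generalized eigenspace `M(μ) = ⋃_{n ≥ 1} ker (ψ - μ·id)ⁿ`
of `ψ`, the element `r • m` lies in the generalized eigenspace `M((β/α)^d μ)` of `ψ`. -/
theorem twist_hom_maps_generalized_eigenspaces
    (k : Type*) [Field k] (R : Type*) [Ring R] [Algebra k R]
    (𝒜 : ℤ → Submodule k R) [GradedAlgebra 𝒜]
    (M : Type*) [AddCommGroup M] [Module k M] [Module R M] [IsScalarTower k R M]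
    (α β : kˣ) (ψ : M →ₗ[k] M)
    (hψ : ∀ (d : ℤ) (r : R), r ∈ 𝒜 d → ∀ m : M,
      ψ (((α ^ d : kˣ) : k) • (r • m)) = ((β ^ d : kˣ) : k) • (r • ψ m))
    (d : ℤ) (r : R) (hr : r ∈ 𝒜 d) (μ : k) (m : M)
    (hm : ∃ n : ℕ, 1 ≤ n ∧ ((ψ - μ • (1 : Module.End k M)) ^ n) m = 0) :
    ∃ n : ℕ, 1 ≤ n ∧
      ((ψ - ((((β / α) ^ d : kˣ) : k) * μ) • (1 : Module.End k M)) ^ n) (r • m) = 0 := by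
  obtain ⟨n, hn, hm⟩ := hm
  have : SMulCommClass k R M := IsScalarTower.to_smulCommClass
  have hψr (x : M) : ψ (r • x) = (((β / α) ^ d : kˣ) : k) • r • ψ x := by
    have h := hψ d r hr x
    rw [map_smul, ← Units.smul_def, ← Units.smul_def] at h
    rw [← Units.smul_def, div_zpow, div_eq_inv_mul, mul_smul, ← h, inv_smul_smul]
  have hsub (x : M) : (ψ - ((((β / α) ^ d : kˣ) : k) * μ) • (1 : Module.End k M)) (r • x) =
      (((β / α) ^ d : kˣ) : k) • r • (ψ - μ • (1 : Module.End k M)) x := by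
    simp only [LinearMap.sub_apply, LinearMap.smul_apply, Module.End.one_apply, hψr, smul_sub,
      mul_smul, smul_comm r μ x]
  refine ⟨n, hn, ?_⟩
  rw [Module.End.pow_smul_eq_of_smul_eq hsub, hm, smul_zero, smul_zero]
end

section
/- Let k be a field, R a ℤ-graded k-algebra, M a left R-module, α, β ∈ kˣ, and ψ : M → M a k-linear map which is a homomorphism of R-modules from M_α to M_β, i.e. ψ(σ_α(r) · m) = σ_β(r) · ψ(m) for all r ∈ R and m ∈ M. Then for every λ ∈ k, the k-subspace Σ_{n∈ℤ} M((β/α)^n λ) of M — the sum over all integers n of the generalized eigenspaces of ψ at the eigenvalues (β/α)^n λ — is an R-submodule of M. -/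
/-- If `ψ` `q`-commutes with the linear map `f`, then `f` intertwines the powers of `ψ - ν`
with those of `ψ - q * ν`, up to powers of `q`. -/
theorem LinearMap.sub_smul_one_pow_apply_of_comp_eq_smul {k M : Type*} [CommRing k]
    [AddCommGroup M] [Module k M] {ψ f : M →ₗ[k] M} {q : k} (h : ∀ m, ψ (f m) = q • f (ψ m))
    (ν : k) (N : ℕ) (m : M) :
    ((ψ - (q * ν) • (1 : Module.End k M)) ^ N) (f m) =
      q ^ N • f (((ψ - ν • (1 : Module.End k M)) ^ N) m) := by
  induction N generalizing m with
  | zero => simp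
  | succ N ih =>
    have hstep : (ψ - (q * ν) • (1 : Module.End k M)) (f m) =
        q • f ((ψ - ν • (1 : Module.End k M)) m) := by
      simp [h, smul_sub, mul_smul]
    rw [pow_succ (ψ - (q * ν) • 1), pow_succ (ψ - ν • 1), Module.End.mul_apply,
      Module.End.mul_apply, hstep, map_smul, ih, smul_smul, ← pow_succ']

/-- Setting as in Statement 2: `ψ : M → M` is `k`-linear and is a
homomorphism of `R`-modules `M_α → M_β`.  Then for every `μ ∈ k` the `k`-subspace
`Σ_{n ∈ ℤ} M((β/α)^n μ)` of `M` — the sum over all integers `n` of the generalized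
eigenspaces `M(ν) = ⋃_{N ≥ 1} ker (ψ - ν·id)^N` of `ψ` at the eigenvalues `(β/α)^n μ` —
is an `R`-submodule of `M`, i.e. closed under the action of every `r ∈ R`. -/
theorem sum_of_generalized_eigenspaces_is_R_submodule
    (k : Type*) [Field k] (R : Type*) [Ring R] [Algebra k R]
    (𝒜 : ℤ → Submodule k R) [GradedAlgebra 𝒜]
    (M : Type*) [AddCommGroup M] [Module k M] [Module R M] [IsScalarTower k R M]
    (α β : kˣ) (ψ : M →ₗ[k] M)
    (hψ : ∀ (d : ℤ) (r : R), r ∈ 𝒜 d → ∀ m : M,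
      ψ (((α ^ d : kˣ) : k) • (r • m)) = ((β ^ d : kˣ) : k) • (r • ψ m))
    (μ : k) :
    ∀ (r : R) (m : M),
      m ∈ (⨆ n : ℤ, ⨆ N : ℕ, ⨆ (_ : 1 ≤ N),
        LinearMap.ker ((ψ - ((((β / α) ^ n : kˣ) : k) * μ) • (1 : Module.End k M)) ^ N)) →
      r • m ∈ (⨆ n : ℤ, ⨆ N : ℕ, ⨆ (_ : 1 ≤ N),
        LinearMap.ker ((ψ - ((((β / α) ^ n : kˣ) : k) * μ) • (1 : Module.End k M)) ^ N)) := by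
  have : SMulCommClass k R M := IsScalarTower.to_smulCommClass
  have hcomm (d : ℤ) (r : R) (hr : r ∈ 𝒜 d) (m : M) :
      ψ (r • m) = (((β / α) ^ d : kˣ) : k) • (r • ψ m) := by
    have h := hψ d r hr m
    rw [map_smul, ← Units.smul_def, ← Units.smul_def] at h
    rw [← Units.smul_def, div_zpow, div_eq_inv_mul, mul_smul, ← h, inv_smul_smul]
  intro r m hm
  induction r using DirectSum.Decomposition.inductionOn 𝒜 with
  | zero => simp
  | add a b ha hb => rw [add_smul]; exact add_mem ha hb
  | @homogeneous d a =>
    obtain ⟨r, hr⟩ := a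
    change Module.toModuleEnd k (S := R) M r m ∈ _
    rw [← Submodule.mem_comap]
    refine SetLike.le_def.mp ?_ hm
    refine iSup_le fun n => iSup_le fun N => iSup_le fun hN => fun x hx => ?_
    rw [Submodule.mem_comap]
    refine Submodule.mem_iSup_of_mem (d + n) <| Submodule.mem_iSup_of_mem N <|
      Submodule.mem_iSup_of_mem hN ?_
    rw [LinearMap.mem_ker] at hx ⊢
    rw [zpow_add, Units.val_mul, mul_assoc]
    have h := LinearMap.sub_smul_one_pow_apply_of_comp_eq_smul
      (f := Module.toModuleEnd k (S := R) M r) (hcomm d r hr) ((((β / α) ^ n : kˣ) : k) * μ) N x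
    rwa [hx, map_zero, smul_zero] at h
end

section
/- Let k be an algebraically closed field and R a ℤ-graded k-algebra which is generated as a k-algebra by finitely many homogeneous elements r_1, …, r_s; set g = max_i |deg r_i|. Let M be a finite-dimensional left R-module, and suppose there exist α, β ∈ kˣ such that M_α ≅ M_β as R-modules and (α/β)^i ≠ 1 for every integer i with 1 ≤ i ≤ g · dim_k M. Then M is gradable. -/
/-- A finite set with at most `n` elements in a commutative group cannot meet every window of `g`
consecutive points of a `q`-orbit when the order of `q` exceeds `g * n`. -/
lemma exists_gap_of_card_le {G : Type*} [CommGroup G] (q : G) (S : Finset G) (g n : ℕ)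
    (hcard : S.card ≤ n) (hq : ∀ i : ℕ, 1 ≤ i → i ≤ g * n → q ^ i ≠ 1) {x : G} (hx : x ∈ S) :
    ∃ t : ℤ, ∀ i : ℤ, 0 ≤ i → i < g → x * q ^ (t + i) ∉ S := by
  rcases Nat.eq_zero_or_pos g with rfl | hg
  · exact ⟨0, fun i h₀ h₁ => absurd h₁ (by simpa using h₀)⟩
  by_contra! hcon
  have hwin : ∀ t : Fin (n + 1), ∃ e : ℕ,
      e ≤ (t : ℕ) * g ∧ (t : ℕ) * g < e + g ∧ x * q ^ e ∈ S := by
    rintro ⟨t, ht⟩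
    rcases t with _ | t
    · exact ⟨0, by simp, by simpa using hg, by simpa using hx⟩
    · obtain ⟨i, h₀, h₁, hi⟩ := hcon (t * g + 1)
      lift i to ℕ using h₀
      refine ⟨t * g + 1 + i, ?_, ?_, ?_⟩
      · simp only [add_mul, one_mul]; lia
      · simp only [add_mul, one_mul]; lia
      · rw [← zpow_natCast]; push_cast; exact hi
  choose e he₁ he₂ he using hwin
  have hlt : ∀ a b : Fin (n + 1), a < b → x * q ^ e a ≠ x * q ^ e b := by
    intro a b hab heq
    have h₁ : ((a : ℕ) + 1) * g ≤ b * g := Nat.mul_le_mul_right g hab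
    have h₂ : (b : ℕ) * g ≤ n * g := Nat.mul_le_mul_right g (Nat.lt_succ_iff.mp b.2)
    have ha := he₁ a
    have hb := he₁ b
    have hb' := he₂ b
    rw [add_mul, one_mul] at h₁
    refine hq (e b - e a) (by lia) (by rw [mul_comm]; lia) ?_
    rw [pow_sub q (by lia), ← mul_left_cancel heq, mul_inv_cancel]
  have hinj : Function.Injective fun a => x * q ^ e a := by
    intro a b hab
    rcases lt_trichotomy a b with h | h | h
    · exact absurd hab (hlt a b h)
    · exact h
    · exact absurd hab.symm (hlt b a h)
  have := Finset.card_le_card_of_injOn (s := Finset.univ) (t := S) (fun a => x * q ^ e a)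
    (fun a _ => he a) hinj.injOn
  simp at this
  lia

/-- A finite set in a commutative group carries an integer labelling compatible with
multiplication by small powers of an element `q` of large order. -/
lemma exists_labelling_of_card_le {G : Type*} [CommGroup G] (q : G) (S : Finset G) (g n : ℕ)
    (hcard : S.card ≤ n) (hq : ∀ i : ℕ, 1 ≤ i → i ≤ g * n → q ^ i ≠ 1) :
    ∃ f : G → ℤ, ∀ x ∈ S, ∀ a : ℤ, a.natAbs ≤ g → q ^ a * x ∈ S → f (q ^ a * x) = f x + a := by
  have hbase : ∀ Q : G ⧸ Subgroup.zpowers q, ∃ c : G, (c : G ⧸ Subgroup.zpowers q) = Q ∧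
      ∀ i : ℤ, 0 ≤ i → i < g → c * q ^ i ∉ S := by
    intro Q
    by_cases h : ∃ x ∈ S, (x : G ⧸ Subgroup.zpowers q) = Q
    · obtain ⟨x, hx, rfl⟩ := h
      obtain ⟨t, ht⟩ := exists_gap_of_card_le q S g n hcard hq hx
      refine ⟨x * q ^ t, ?_, fun i h₀ h₁ => ?_⟩
      · exact QuotientGroup.mk_mul_of_mem x (Subgroup.zpow_mem_zpowers q t)
      · rw [mul_assoc, ← zpow_add]
        exact ht i h₀ h₁
    · push Not at h
      obtain ⟨c, rfl⟩ := QuotientGroup.mk_surjective Q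
      refine ⟨c, rfl, fun i _ _ hi => h _ hi ?_⟩
      exact QuotientGroup.mk_mul_of_mem c (Subgroup.zpow_mem_zpowers q i)
  choose c hc hgap using hbase
  have hexp : ∀ x : G, ∃ j : ℤ, c x * q ^ j = x := by
    intro x
    obtain ⟨j, hj⟩ := Subgroup.mem_zpowers_iff.mp (QuotientGroup.eq.mp (hc (x : G ⧸ _)))
    exact ⟨j, by rw [hj, mul_inv_cancel_left]⟩
  choose j hj using hexp
  refine ⟨fun x => j x % orderOf q, fun x hx a ha hxa => ?_⟩
  have hcoset : ((q ^ a * x : G) : G ⧸ Subgroup.zpowers q) = x := by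
    rw [mul_comm]
    exact QuotientGroup.mk_mul_of_mem x (Subgroup.zpow_mem_zpowers q a)
  have hx' : c x * q ^ (j x % orderOf q) = x := by rw [zpow_mod_orderOf, hj]
  have hxa' := hj (q ^ a * x)
  rw [hcoset] at hxa'
  have hmod : j (q ^ a * x) ≡ j x % orderOf q + a [ZMOD orderOf q] := by
    rw [← zpow_eq_zpow_iff_modEq]
    apply mul_left_cancel (a := c x)
    rw [hxa', zpow_add, ← mul_assoc, hx', mul_comm]
  have hpow : ∀ m : ℤ, j (q ^ a * x) ≡ m [ZMOD orderOf q] → c x * q ^ m = q ^ a * x := by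
    intro m hm
    rw [← zpow_eq_zpow_iff_modEq.mpr hm, hxa']
  change j (q ^ a * x) % orderOf q = _
  rw [hmod.eq]
  rcases Nat.eq_zero_or_pos (orderOf q) with h₀ | hpos
  · simp [h₀]
  have hN : (0 : ℤ) < orderOf q := by exact_mod_cast hpos
  have hl := Int.emod_nonneg (j x) hN.ne'
  have hu := Int.emod_lt_of_pos (j x) hN
  refine Int.emod_eq_of_lt ?_ ?_
  · by_contra! hneg
    exact hgap x _ hl (by lia) (hx'.symm ▸ hx)
  · by_contra! hbig
    refine hgap x (j x % orderOf q + a - orderOf q) (by lia) (by lia) ?_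
    rw [hpow _ (hmod.trans ?_)]
    · exact hxa
    · exact Int.modEq_iff_dvd.mpr ⟨-1, by ring⟩

/-- Grouping an independent family along the fibres of a map gives an independent family. -/
lemma iSupIndep.iSup_fiber {ι κ k M : Type*} [Ring k] [AddCommGroup M] [Module k M]
    {V : ι → Submodule k M} (hV : iSupIndep V) (f : ι → κ) :
    iSupIndep fun j => ⨆ i ∈ f ⁻¹' {j}, V i := by
  intro j
  refine (hV.disjoint_biSup_biSup (s := f ⁻¹' {j}) (t := (f ⁻¹' {j})ᶜ)
    disjoint_compl_right).mono_right ?_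
  refine iSup₂_le fun l hl => iSup₂_le fun i hi => ?_
  refine le_iSup₂_of_le i ?_ le_rfl
  rintro (h : f i = j)
  exact hl (Eq.trans (Eq.symm hi) h)

/-- A decomposition compatible with homogeneous generators is compatible with the whole grading. -/
lemma smul_mem_of_generators {k R M : Type*} [Field k] [Ring R] [Algebra k R]
    (𝒜 : ℤ → Submodule k R) [GradedAlgebra 𝒜] [AddCommGroup M] [Module k M] [Module R M]
    [IsScalarTower k R M] {ι : Type*} (r : ι → R) (d : ι → ℤ) (hr : ∀ i, r i ∈ 𝒜 (d i))
    (hgen : Algebra.adjoin k (Set.range r) = ⊤) (ℳ : ℤ → Submodule k M)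
    (h : ∀ i j, ∀ m ∈ ℳ j, r i • m ∈ ℳ (d i + j)) {i j : ℤ} {x : R} {m : M}
    (hx : x ∈ 𝒜 i) (hm : m ∈ ℳ j) : x • m ∈ ℳ (i + j) := by
  classical
  have key : ∀ i j, ∀ m ∈ ℳ j, (DirectSum.decompose 𝒜 x i : R) • m ∈ ℳ (i + j) := by
    have hx' : x ∈ Algebra.adjoin k (Set.range r) := hgen ▸ Algebra.mem_top
    have hom : ∀ (e : ℤ) (y : R), y ∈ 𝒜 e → (∀ j, ∀ m ∈ ℳ j, y • m ∈ ℳ (e + j)) →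
        ∀ i j, ∀ m ∈ ℳ j, (DirectSum.decompose 𝒜 y i : R) • m ∈ ℳ (i + j) := by
      intro e y hy hym i j m hm
      by_cases hei : e = i
      · subst hei
        rw [DirectSum.decompose_of_mem_same 𝒜 hy]
        exact hym j m hm
      · rw [DirectSum.decompose_of_mem_ne 𝒜 hy hei, zero_smul]
        exact zero_mem _
    clear hx hm
    induction hx' using Algebra.adjoin_induction with
    | mem y hy =>
      obtain ⟨l, rfl⟩ := hy
      exact hom (d l) _ (hr l) (h l)
    | algebraMap a =>
      refine hom 0 _ (SetLike.algebraMap_mem_graded 𝒜 a) fun j m hm => ?_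
      rw [algebraMap_smul, zero_add]
      exact (ℳ j).smul_mem a hm
    | add y z _ _ hy hz =>
      intro i j m hm
      rw [DirectSum.decompose_add, DirectSum.add_apply, Submodule.coe_add, add_smul]
      exact add_mem (hy i j m hm) (hz i j m hm)
    | mul y z _ _ hy hz =>
      intro i j m hm
      rw [DirectSum.decompose_mul, DirectSum.coe_mul_apply, Finset.sum_smul]
      refine sum_mem fun ab hab => ?_
      rw [← (Finset.mem_filter.mp hab).2, mul_smul, add_assoc]
      exact hy _ _ _ (hz _ _ _ hm)
  simpa only [DirectSum.decompose_of_mem_same 𝒜 hx] using key i j m hm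

/-- A map which commutes with `ψ` up to a scalar `c` sends the generalized `μ`-eigenspace of `ψ`
to the generalized `c * μ`-eigenspace. -/
lemma mem_maxGenEigenspace_of_twisted_commute {k M : Type*} [Field k] [AddCommGroup M]
    [Module k M] (ψ T : Module.End k M) (c : k) (h : ∀ m, ψ (T m) = c • T (ψ m)) (μ : k) {m : M} (hm : m ∈ ψ.maxGenEigenspace μ) :
    T m ∈ ψ.maxGenEigenspace (c * μ) := by
  have hone : ∀ m, (ψ - (c * μ) • (1 : Module.End k M)) (T m) =
      c • T ((ψ - μ • (1 : Module.End k M)) m) := by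
    intro m
    simp [h, smul_sub, mul_smul]
  have hpow : ∀ (n : ℕ) m, ((ψ - (c * μ) • (1 : Module.End k M)) ^ n) (T m) =
      c ^ n • T (((ψ - μ • (1 : Module.End k M)) ^ n) m) := by
    intro n
    induction n with
    | zero => simp
    | succ n ih =>
      intro m
      rw [pow_succ, Module.End.mul_apply, hone, map_smul, ih, pow_succ (ψ - μ • 1),
        Module.End.mul_apply, smul_smul, pow_succ' c]
  obtain ⟨n, hn⟩ := (ψ.mem_maxGenEigenspace μ m).mp hm
  exact (ψ.mem_maxGenEigenspace _ _).mpr ⟨n, by rw [hpow, hn, map_zero, smul_zero]⟩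

/-- Let `k` be an algebraically closed field and `R` a `ℤ`-graded
`k`-algebra generated (as a `k`-algebra) by finitely many homogeneous elements
`r 1, …, r s` with `r i ∈ 𝒜 (d i)`; set `g = max_i |d i|`.  Let `M` be a
finite-dimensional `R`-module and suppose there are `α, β ∈ kˣ` such that `M_α ≅ M_β` as
`R`-modules (an `R`-module isomorphism `M_α → M_β` is a `k`-linear automorphism `ψ` of `M`
with `ψ (α^e • (x • m)) = β^e • (x • ψ m)` for all homogeneous `x ∈ 𝒜 e`) and
`(α/β)^i ≠ 1` for every integer `1 ≤ i ≤ g · dim_k M`.  Then `M` is gradable: it admits a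
`ℤ`-grading compatible with the grading of `R`. -/
theorem gradable_of_twist_iso_of_order
    (k : Type*) [Field k] [IsAlgClosed k] (R : Type*) [Ring R] [Algebra k R]
    (𝒜 : ℤ → Submodule k R) [GradedAlgebra 𝒜]
    (s : ℕ) (r : Fin s → R) (d : Fin s → ℤ)
    (hr : ∀ i, r i ∈ 𝒜 (d i))
    (hgen : Algebra.adjoin k (Set.range r) = ⊤)
    (g : ℕ) (hg : g = Finset.univ.sup fun i => (d i).natAbs)
    (M : Type*) [AddCommGroup M] [Module k M] [Module R M] [IsScalarTower k R M]
    [FiniteDimensional k M]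
    (α β : kˣ)
    (hiso : ∃ ψ : M ≃ₗ[k] M, ∀ (e : ℤ) (x : R), x ∈ 𝒜 e → ∀ m : M,
      ψ (((α ^ e : kˣ) : k) • (x • m)) = ((β ^ e : kˣ) : k) • (x • ψ m))
    (hroot : ∀ i : ℕ, 1 ≤ i → i ≤ g * Module.finrank k M → (α / β) ^ i ≠ 1) :
    ∃ ℳ : ℤ → Submodule k M, DirectSum.IsInternal ℳ ∧
      ∀ (i j : ℤ) (x : R) (m : M), x ∈ 𝒜 i → m ∈ ℳ j → x • m ∈ ℳ (i + j) := by
  classical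
  obtain ⟨ψ, hψ⟩ := hiso
  let V : kˣ → Submodule k M := fun u => Module.End.maxGenEigenspace (ψ : Module.End k M) u
  have hind : iSupIndep V :=
    (Module.End.independent_maxGenEigenspace (ψ : Module.End k M)).comp Units.val_injective
  have hzero : Module.End.maxGenEigenspace (ψ : Module.End k M) 0 = ⊥ := by
    rw [eq_bot_iff]
    intro m hm
    obtain ⟨n, hn⟩ := (Module.End.mem_maxGenEigenspace _ _ _).mp hm
    rw [zero_smul, sub_zero] at hn
    have hinj : Function.Injective ((ψ : Module.End k M) ^ n) := by
      rw [Module.End.coe_pow]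
      exact ψ.injective.iterate n
    exact hinj (hn.trans (map_zero _).symm)
  have htop : ⨆ u, V u = ⊤ := by
    rw [eq_top_iff, ← Module.End.iSup_maxGenEigenspace_eq_top (ψ : Module.End k M)]
    refine iSup_le fun μ => ?_
    rcases eq_or_ne μ 0 with rfl | hμ
    · rw [hzero]
      exact bot_le
    · exact le_iSup V (Units.mk0 μ hμ)
  have hfin : {u | V u ≠ ⊥}.Finite := WellFoundedGT.finite_ne_bot_of_iSupIndep hind
  have hcard : hfin.toFinset.card ≤ Module.finrank k M := by
    have : Fintype {u // V u ≠ ⊥} := hfin.fintype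
    refine le_trans (le_of_eq ?_) hind.subtype_ne_bot_le_finrank
    rw [← Nat.card_eq_card_finite_toFinset hfin]
    exact Nat.card_eq_fintype_card (α := {u // V u ≠ ⊥})
  have hq : ∀ i : ℕ, 1 ≤ i → i ≤ g * Module.finrank k M → (β / α) ^ i ≠ 1 := by
    intro i h₁ h₂ h₃
    refine hroot i h₁ h₂ ?_
    rw [← inv_div, inv_pow, h₃, inv_one]
  obtain ⟨f, hf⟩ := exists_labelling_of_card_le (β / α) hfin.toFinset g _ hcard hq
  have hshift : ∀ (e : ℤ) (x : R), x ∈ 𝒜 e → ∀ u, ∀ m ∈ V u, x • m ∈ V ((β / α) ^ e * u) := by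
    intro e x hx u m hm
    refine mem_maxGenEigenspace_of_twisted_commute (ψ : Module.End k M) (Algebra.lsmul k k M x)
      (((β / α) ^ e : kˣ) : k) (fun m => ?_) u hm
    have h := hψ e x hx m
    rw [map_smul] at h
    change ψ (x • m) = (((β / α) ^ e : kˣ) : k) • x • ψ m
    rw [div_zpow, div_eq_inv_mul, Units.val_mul, mul_smul, ← h, smul_smul, ← Units.val_mul,
      inv_mul_cancel, Units.val_one, one_smul]
  refine ⟨fun j => ⨆ u ∈ f ⁻¹' {j}, V u,
    DirectSum.isInternal_submodule_of_iSupIndep_of_iSup_eq_top (hind.iSup_fiber f) ?_, ?_⟩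
  · rw [eq_top_iff, ← htop]
    exact iSup_le fun u => le_iSup_of_le (f u) (le_iSup₂_of_le u rfl le_rfl)
  · intro i j x m hx hm
    refine smul_mem_of_generators 𝒜 r d hr hgen (fun j => ⨆ u ∈ f ⁻¹' {j}, V u)
      (fun l j m hm => ?_) hx hm
    have hle : (⨆ u ∈ f ⁻¹' {j}, V u) ≤
        (⨆ u ∈ f ⁻¹' {d l + j}, V u).comap (Algebra.lsmul k k M (r l)) := by
      refine iSup₂_le fun u hu m hm => ?_
      have hmem := hshift (d l) (r l) (hr l) u m hm
      change r l • m ∈ ⨆ u ∈ f ⁻¹' {d l + j}, V u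
      by_cases hne : r l • m = 0
      · rw [hne]
        exact zero_mem _
      have hm0 : m ≠ 0 := fun h => hne (by rw [h, smul_zero])
      have hd : (d l).natAbs ≤ g :=
        hg ▸ Finset.le_sup (f := fun i => (d i).natAbs) (Finset.mem_univ l)
      have hval := hf u (hfin.mem_toFinset.mpr ((Submodule.ne_bot_iff _).mpr ⟨m, hm, hm0⟩)) (d l)
        hd (hfin.mem_toFinset.mpr ((Submodule.ne_bot_iff _).mpr ⟨_, hmem, hne⟩))
      refine (le_iSup₂_of_le ((β / α) ^ d l * u) ?_ le_rfl :
        V ((β / α) ^ d l * u) ≤ ⨆ u ∈ f ⁻¹' {d l + j}, V u) hmem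
      rw [Set.mem_preimage, Set.mem_singleton_iff, hval, show f u = j from hu, add_comm]
    exact hle hm
end

section
/- Let k be a field and R a ℤ-graded k-algebra generated as a k-algebra by homogeneous elements whose degrees all have absolute value at most g. Let M be a finite-dimensional left R-module and let n be a positive integer with n > g · dim_k M. Suppose M admits a ℤ/nℤ-grading, i.e. a direct sum decomposition M = ⊕_{c∈ℤ/nℤ} M_c into k-subspaces such that R_i · M_c ⊆ M_{c + (i mod n)} for all i ∈ ℤ and c ∈ ℤ/nℤ. Then M is gradable, i.e. the ℤ/nℤ-grading can be lifted: M admits a ℤ-grading compatible with the ℤ-grading of R. -/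
/-- A family of submodules indexed by `ZMod n` that is independent in a space of dimension less
than `n / g` has a run of `g` consecutive zero members. -/
theorem exists_zmod_run_eq_bot {k M : Type*} [Field k] [AddCommGroup M] [Module k M]
    [FiniteDimensional k M] {n g : ℕ} [NeZero n] (hn : g * Module.finrank k M < n)
    {ℳ : ZMod n → Submodule k M} (hind : iSupIndep ℳ) :
    ∃ b : ZMod n, ∀ e : ℕ, e < g → ℳ (b + e) = ⊥ := by
  classical
  let T : Finset (ZMod n) := Finset.univ.filter fun c => ℳ c ≠ ⊥
  have hT : T.card ≤ Module.finrank k M := by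
    have h := hind.subtype_ne_bot_le_finrank
    rwa [Fintype.card_subtype] at h
  let B : Finset (ZMod n) := (T ×ˢ Finset.range g).image fun p => p.1 - (p.2 : ZMod n)
  have hB : B.card < (Finset.univ : Finset (ZMod n)).card := by
    rw [Finset.card_univ, ZMod.card]
    calc B.card ≤ (T ×ˢ Finset.range g).card := Finset.card_image_le
      _ = g * T.card := by rw [Finset.card_product, Finset.card_range, mul_comm]
      _ ≤ g * Module.finrank k M := Nat.mul_le_mul_left _ hT
      _ < n := hn
  obtain ⟨b, -, hb⟩ := Finset.exists_mem_notMem_of_card_lt_card hB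
  refine ⟨b, fun e he => ?_⟩
  by_contra h
  exact hb (Finset.mem_image.2 ⟨(b + e, e), by simp [T, h, he], by simp⟩)

/-- The lift of a family indexed by `ZMod n` to `ℤ`, placed in the window `[0, n)` so that
position `0` corresponds to the class `b`. -/
def windowLift {k M : Type*} [Field k] [AddCommGroup M] [Module k M] {n : ℕ}
    (ℳ : ZMod n → Submodule k M) (b : ZMod n) (j : ℤ) : Submodule k M :=
  if 0 ≤ j ∧ j < n then ℳ (b + j) else ⊥

theorem isInternal_windowLift {k M : Type*} [Field k] [AddCommGroup M] [Module k M] {n : ℕ}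
    [NeZero n] {ℳ : ZMod n → Submodule k M} (h : DirectSum.IsInternal ℳ) (b : ZMod n) :
    DirectSum.IsInternal (windowLift ℳ b) := by
  rw [DirectSum.isInternal_submodule_iff_iSupIndep_and_iSup_eq_top] at h ⊢
  refine ⟨fun j => ?_, ?_⟩
  · by_cases hj : 0 ≤ j ∧ j < n
    · rw [windowLift, if_pos hj]
      refine (h.1 (b + j)).mono_right (iSup₂_le fun i hij => ?_)
      by_cases hi : 0 ≤ i ∧ i < n
      · rw [windowLift, if_pos hi]
        refine le_iSup₂_of_le (b + (i : ZMod n)) (fun he => hij ?_) le_rfl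
        have he := (ZMod.intCast_eq_intCast_iff' _ _ _).1 (add_left_cancel he)
        rwa [Int.emod_eq_of_lt hi.1 hi.2, Int.emod_eq_of_lt hj.1 hj.2] at he
      · simp [windowLift, hi]
    · simp [windowLift, hj]
  · rw [eq_top_iff, ← h.2]
    refine iSup_le fun c => le_iSup_of_le ((c - b).val : ℤ) ?_
    rw [windowLift, if_pos ⟨by positivity, by exact_mod_cast (c - b).val_lt⟩]
    simp

/-- An algebra generated by homogeneous elements respects a family of submodules as soon as the
generators do. -/
theorem smul_mem_of_adjoin_eq_top {k R M ι : Type*} [Field k] [Ring R] [Algebra k R]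
    [AddCommGroup M] [Module k M] [Module R M] [IsScalarTower k R M]
    [AddCommGroup ι] [DecidableEq ι] (𝒜 : ι → Submodule k R) [GradedAlgebra 𝒜]
    {S : Set R} (hgen : Algebra.adjoin k S = ⊤) (𝒩 : ι → Submodule k M)
    (hS : ∀ x ∈ S, ∃ i, x ∈ 𝒜 i ∧ ∀ j, ∀ m ∈ 𝒩 j, x • m ∈ 𝒩 (i + j))
    {i j : ι} {x : R} {m : M} (hx : x ∈ 𝒜 i) (hm : m ∈ 𝒩 j) : x • m ∈ 𝒩 (i + j) := by
  have hmon : ∀ w ∈ Submonoid.closure S,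
      ∃ a, w ∈ 𝒜 a ∧ ∀ j, ∀ m ∈ 𝒩 j, w • m ∈ 𝒩 (a + j) := by
    intro w hw
    induction hw using Submonoid.closure_induction with
    | mem w hw => exact hS w hw
    | one => exact ⟨0, SetLike.one_mem_graded 𝒜, fun j m hm => by simpa using hm⟩
    | mul v w _ _ hv hw =>
      obtain ⟨a, hva, hv⟩ := hv
      obtain ⟨c, hwc, hw⟩ := hw
      refine ⟨a + c, SetLike.mul_mem_graded hva hwc, fun j m hm => ?_⟩
      rw [mul_smul, add_assoc]
      exact hv _ _ (hw _ _ hm)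
  have hspan : x ∈ Submodule.span k (Submonoid.closure S : Set R) := by
    rw [← Algebra.adjoin_eq_span, hgen]
    trivial
  have hcomp : (DirectSum.decompose 𝒜 x i : R) • m ∈ 𝒩 (i + j) := by
    clear hx
    induction hspan using Submodule.span_induction with
    | mem w hw =>
      obtain ⟨a, hwa, hw⟩ := hmon w hw
      by_cases hai : a = i
      · subst hai
        rw [DirectSum.decompose_of_mem_same 𝒜 hwa]
        exact hw _ _ hm
      · rw [DirectSum.decompose_of_mem_ne 𝒜 hwa hai, zero_smul]
        exact zero_mem _
    | zero => simp
    | add v w _ _ hv hw =>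
      rw [DirectSum.decompose_add, DirectSum.add_apply, Submodule.coe_add, add_smul]
      exact add_mem hv hw
    | smul c w _ hw =>
      rw [DirectSum.decompose_smul, DirectSum.smul_apply, Submodule.coe_smul, smul_assoc]
      exact Submodule.smul_mem _ _ hw
  rwa [DirectSum.decompose_of_mem_same 𝒜 hx] at hcomp

/-- Let `k` be a field and `R` a `ℤ`-graded `k`-algebra generated as a
`k`-algebra by a set `S` of homogeneous elements whose degrees all have absolute value at
most `g`.  Let `M` be a finite-dimensional `R`-module and `n` a positive integer with
`n > g · dim_k M`.  Suppose `M` admits a `ℤ/nℤ`-grading `M = ⊕_{c : ZMod n} ℳ c`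
compatible with the grading of `R` reduced mod `n` (i.e. `𝒜 i • ℳ c ⊆ ℳ (c + i mod n)`).
Then `M` is gradable: it admits a `ℤ`-grading compatible with the `ℤ`-grading of `R`. -/
theorem gradable_of_zmod_gradable
    (k : Type*) [Field k] (R : Type*) [Ring R] [Algebra k R]
    (𝒜 : ℤ → Submodule k R) [GradedAlgebra 𝒜]
    (g : ℕ) (S : Set R)
    (hS : ∀ x ∈ S, ∃ i : ℤ, i.natAbs ≤ g ∧ x ∈ 𝒜 i)
    (hgen : Algebra.adjoin k S = ⊤)
    (M : Type*) [AddCommGroup M] [Module k M] [Module R M] [IsScalarTower k R M]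
    [FiniteDimensional k M]
    (n : ℕ) (hpos : 0 < n) (hn : g * Module.finrank k M < n)
    (ℳ : ZMod n → Submodule k M) (hdec : DirectSum.IsInternal ℳ)
    (hsmul : ∀ (i : ℤ) (c : ZMod n) (x : R) (m : M),
      x ∈ 𝒜 i → m ∈ ℳ c → x • m ∈ ℳ (c + (i : ZMod n))) :
    ∃ 𝒩 : ℤ → Submodule k M, DirectSum.IsInternal 𝒩 ∧
      ∀ (i j : ℤ) (x : R) (m : M), x ∈ 𝒜 i → m ∈ 𝒩 j → x • m ∈ 𝒩 (i + j) := by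
  have : NeZero n := ⟨hpos.ne'⟩
  obtain ⟨b, hb⟩ := exists_zmod_run_eq_bot hn hdec.submodule_iSupIndep
  refine ⟨windowLift ℳ b, isInternal_windowLift hdec b, fun i j x m hx hm =>
    smul_mem_of_adjoin_eq_top 𝒜 hgen _ (fun x hx => ?_) hx hm⟩
  obtain ⟨i, hi, hxi⟩ := hS x hx
  refine ⟨i, hxi, fun j m hm => ?_⟩
  have hrun : ∀ e : ℤ, 0 ≤ e → e < g → ℳ (b + (e : ZMod n)) = ⊥ := by
    intro e he heg
    lift e to ℕ using he
    simpa using hb e (by exact_mod_cast heg)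
  by_cases hj : 0 ≤ j ∧ j < n
  · rw [windowLift, if_pos hj] at hm
    have hxm := hsmul i _ x m hxi hm
    by_cases hjg : j < g
    · rw [hrun j hj.1 hjg, Submodule.mem_bot] at hm
      simp [hm]
    by_cases hij : i + j < n
    · rw [windowLift, if_pos ⟨by omega, hij⟩]
      convert hxm using 2
      push_cast
      ring
    · have hwrap : b + (j : ZMod n) + (i : ZMod n) = b + ((i + j - n : ℤ) : ZMod n) := by
        push_cast
        rw [ZMod.natCast_self]
        ring
      rw [hwrap, hrun _ (by omega) (by omega), Submodule.mem_bot] at hxm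
      simp [hxm]
  · rw [windowLift, if_neg hj, Submodule.mem_bot] at hm
    simp [hm]
end

section
/- Let k be an algebraically closed field, R a ℤ-graded k-algebra which is finitely generated as a k-algebra, and M a finite-dimensional left R-module. Then exactly one of the following holds: (1) the R-modules M_α for α ∈ kˣ are all isomorphic to one another, and M is gradable; (2) for every α ∈ kˣ there are only finitely many β ∈ kˣ with M_α ≅ M_β as R-modules, and M is not gradable. -/
open Module Module.End

/-- If the powers of `t` with small positive exponents differ from `1`, a finite set of nonzero
elements of a field admits an integer-valued degree function for which multiplication by `t ^ e`
raises the degree by `e`, as long as `|e| ≤ E`. -/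
lemma exists_degree_of_pow_ne_one {k : Type*} [Field k] (Λ : Finset k) (hΛ : 0 ∉ Λ) (t : kˣ)
    (E : ℕ) (ht : ∀ i : ℕ, 0 < i → i ≤ (Λ.card + 1) * E → t ^ i ≠ 1) :
    ∃ f : k → ℤ, ∀ μ ∈ Λ, ∀ e : ℤ, |e| ≤ E → ((t ^ e : kˣ) : k) * μ ∈ Λ →
      f (((t ^ e : kˣ) : k) * μ) = f μ + e := by
  classical
  -- `f μ` is the least `n` such that `t ^ (-n) * μ` is preceded by `E` consecutive gaps of `Λ`
  let P : k → ℕ → Prop := fun μ n ↦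
    ∀ i : ℕ, 1 ≤ i → i ≤ E → ((t ^ (-(n + i : ℤ)) : kˣ) : k) * μ ∉ Λ
  have hP : ∀ μ ∈ Λ, ∃ n, P μ n := by
    intro μ hμ
    have hμ0 : μ ≠ 0 := fun h ↦ hΛ (h ▸ hμ)
    by_contra! hn
    have hn' : ∀ m : ℕ, ∃ i : ℕ, 1 ≤ i ∧ i ≤ E ∧
        ((t ^ (-((m * E : ℕ) + i : ℤ)) : kˣ) : k) * μ ∈ Λ := by
      intro m
      have := hn (m * E)
      simp only [P] at this
      push Not at this
      exact this
    choose i hi1 hiE hiΛ using hn'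
    obtain ⟨a, ha, b, hb, hab, heq⟩ := Finset.exists_ne_map_eq_of_card_lt_of_maps_to
      (s := Finset.range (Λ.card + 1)) (t := Λ)
      (f := fun m : ℕ ↦ ((t ^ (-((m * E : ℕ) + i m : ℤ)) : kˣ) : k) * μ)
      (by simp) (fun m _ ↦ hiΛ m)
    wlog hlt : a < b generalizing a b
    · exact this b hb a ha hab.symm heq.symm (by omega)
    have heq' := Units.ext (mul_right_cancel₀ hμ0 heq)
    have h1 : a * E + i a < b * E + i b := by nlinarith [hi1 b, hiE a]
    have h2 : b * E + i b ≤ (Λ.card + 1) * E := by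
      have := Finset.mem_range.1 hb
      nlinarith [hiE b]
    refine ht ((b * E + i b) - (a * E + i a)) (by omega) (by omega) ?_
    have heq'' : t ^ (-((a * E + i a : ℕ) : ℤ)) = t ^ (-((b * E + i b : ℕ) : ℤ)) := by
      simpa using heq'
    rw [← zpow_natCast, Nat.cast_sub h1.le, sub_eq_add_neg, zpow_add, heq'', ← zpow_add]
    simp
  let f : k → ℕ := fun μ ↦ if h : ∃ n, P μ n then Nat.find h else 0
  have hf : ∀ μ ∈ Λ, ∀ e : ℕ, e ≤ E → ((t ^ (e : ℤ) : kˣ) : k) * μ ∈ Λ →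
      f (((t ^ (e : ℤ) : kˣ) : k) * μ) = f μ + e := by
    intro μ hμ e he hμe
    have hshift : ∀ n, P (((t ^ (e : ℤ) : kˣ) : k) * μ) (n + e) ↔ P μ n := by
      intro n
      refine forall_congr' fun i ↦ forall₂_congr fun _ _ ↦ ?_
      rw [← mul_assoc, ← Units.val_mul, ← zpow_add]
      congr! 4
      push_cast
      congr 1
      ring
    have hsmall : ∀ n < e, ¬ P (((t ^ (e : ℤ) : kˣ) : k) * μ) n := by
      intro n hn h
      refine h (e - n) (by omega) (by omega) ?_
      rw [← mul_assoc, ← Units.val_mul, ← zpow_add, Nat.cast_sub hn.le]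
      simpa using hμ
    simp only [f, dif_pos (hP _ hμ), dif_pos (hP _ hμe)]
    rw [Nat.find_eq_iff]
    refine ⟨(hshift _).2 (Nat.find_spec (hP _ hμ)), fun n hn h ↦ ?_⟩
    rcases lt_or_ge n e with hne | hne
    · exact hsmall n hne h
    · obtain ⟨m, rfl⟩ := Nat.exists_eq_add_of_le' hne
      exact Nat.find_min (hP _ hμ) (by omega) ((hshift m).1 h)
  refine ⟨fun μ ↦ f μ, fun μ hμ e he hμe ↦ ?_⟩
  obtain ⟨n, rfl | rfl⟩ := e.eq_nat_or_neg
  · have := hf μ hμ n (by simpa using he) hμe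
    simp only [this, Nat.cast_add]
  · have := hf _ hμe n (by simpa using he)
    rw [← mul_assoc, ← Units.val_mul, ← zpow_add] at this
    simp only [add_neg_cancel, zpow_zero, Units.val_one, one_mul] at this
    simp only [this hμ, Nat.cast_add, add_neg_cancel_right]

/-- Coarsening an independent family along a map of index sets. -/
lemma isInternal_iSup_fiber {k M ι κ : Type*} [DecidableEq κ] [Field k] [AddCommGroup M]
    [Module k M] (V : ι → Submodule k M) (hV : iSupIndep V) (htop : ⨆ i, V i = ⊤) (f : ι → κ) :
    DirectSum.IsInternal fun j ↦ ⨆ i ∈ f ⁻¹' {j}, V i := by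
  refine DirectSum.isInternal_submodule_of_iSupIndep_of_iSup_eq_top ?_ ?_
  · intro j
    refine (hV.disjoint_biSup_biSup (s := f ⁻¹' {j}) (t := f ⁻¹' {j}ᶜ) ?_).mono_right ?_
    · exact Disjoint.preimage _ disjoint_compl_right
    · refine iSup₂_le fun j' hj' ↦ biSup_mono fun i hi ↦ ?_
      simp only [Set.mem_preimage, Set.mem_singleton_iff] at hi
      simpa [hi] using hj'
  · rw [eq_top_iff, ← htop]
    exact iSup_le fun i ↦ le_iSup_of_le (f i) (le_biSup V (i := i) rfl)

/-- An operator that commutes with `ψ` up to a scalar permutes its generalized eigenspaces. -/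
lemma mapsTo_maxGenEigenspace_of_mul_eq_smul {k M : Type*} [Field k] [AddCommGroup M]
    [Module k M] (ψ g : End k M) (c : k) (h : ψ * g = c • (g * ψ)) (μ : k) {m : M}
    (hm : m ∈ ψ.maxGenEigenspace μ) : g m ∈ ψ.maxGenEigenspace (c * μ) := by
  rw [mem_maxGenEigenspace] at hm ⊢
  obtain ⟨n, hn⟩ := hm
  have hpow : ∀ l : ℕ, ((ψ - (c * μ) • 1) ^ l) (g m) = c ^ l • g (((ψ - μ • 1) ^ l) m) := by
    intro l
    induction l with
    | zero => simp
    | succ l ih =>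
      have h' : ∀ y, ψ (g y) = c • g (ψ y) := fun y ↦ LinearMap.congr_fun h y
      rw [pow_succ', Module.End.mul_apply, ih, pow_succ' (ψ - μ • 1), Module.End.mul_apply]
      simp only [LinearMap.sub_apply, LinearMap.smul_apply, Module.End.one_apply, map_smul,
        map_sub, h']
      module
  exact ⟨n, by rw [hpow, hn, map_zero, smul_zero]⟩

/-- Scaling the degree `j` part by `t ^ j` is an automorphism. -/
lemma exists_linearEquiv_smul_zpow {k M : Type*} [Field k] [AddCommGroup M] [Module k M]
    (ℳ : ℤ → Submodule k M) (hℳ : DirectSum.IsInternal ℳ) (t : kˣ) :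
    ∃ ψ : M ≃ₗ[k] M, ∀ j, ∀ m ∈ ℳ j, ψ m = ((t ^ j : kˣ) : k) • m := by
  let e := LinearEquiv.ofBijective (DirectSum.coeLinearMap ℳ) hℳ
  let D : (DirectSum ℤ fun j ↦ ℳ j) ≃ₗ[k] (DirectSum ℤ fun j ↦ ℳ j) :=
    DFinsupp.mapRange.linearEquiv fun j ↦ LinearEquiv.smulOfUnit (t ^ j)
  refine ⟨e.symm ≪≫ₗ D ≪≫ₗ e, fun j m hm ↦ ?_⟩
  lift m to ℳ j using hm
  have h : e.symm m = DirectSum.lof k ℤ (fun j ↦ ℳ j) j m := by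
    rw [LinearEquiv.symm_apply_eq]
    exact (DirectSum.coeLinearMap_lof ℳ j m).symm
  have hD : D (DirectSum.lof k ℤ (fun j ↦ ℳ j) j m) =
      DirectSum.lof k ℤ (fun j ↦ ℳ j) j (((t ^ j : kˣ) : k) • m) :=
    DFinsupp.mapRange_single (hf := fun j ↦ map_zero (LinearEquiv.smulOfUnit (t ^ j)))
  rw [LinearEquiv.trans_apply, LinearEquiv.trans_apply, h, hD]
  exact DirectSum.coeLinearMap_lof ℳ j _

/-- The twists of a gradable module are all isomorphic. -/
lemma exists_linearEquiv_twist_of_gradable {k R M : Type*} [Field k] [Ring R] [Algebra k R]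
    (𝒜 : ℤ → Submodule k R) [AddCommGroup M] [Module k M] [Module R M] [IsScalarTower k R M]
    (ℳ : ℤ → Submodule k M) (hℳ : DirectSum.IsInternal ℳ)
    (hsmul : ∀ (i j : ℤ) (x : R) (m : M), x ∈ 𝒜 i → m ∈ ℳ j → x • m ∈ ℳ (i + j)) (α β : kˣ) :
    ∃ ψ : M ≃ₗ[k] M, ∀ (e : ℤ) (x : R), x ∈ 𝒜 e → ∀ m : M,
      ψ (((α ^ e : kˣ) : k) • (x • m)) = ((β ^ e : kˣ) : k) • (x • ψ m) := by
  obtain ⟨ψ, hψ⟩ := exists_linearEquiv_smul_zpow ℳ hℳ (β / α)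
  refine ⟨ψ, fun e x hx m ↦ ?_⟩
  have hm : m ∈ ⨆ j, ℳ j := hℳ.submodule_iSup_eq_top ▸ Submodule.mem_top
  induction hm using Submodule.iSup_induction' with
  | zero => simp
  | add m₁ m₂ _ _ h₁ h₂ => simp only [smul_add, map_add, h₁, h₂]
  | mem j m hm =>
    rw [map_smul, hψ _ _ (hsmul e j x m hx hm), hψ _ _ hm, smul_comm x, smul_smul, smul_smul,
      ← Units.val_mul, ← Units.val_mul, zpow_add, ← mul_assoc, ← mul_zpow, mul_div_cancel]

/-- Compatibility of a grading with a module structure can be checked on the homogeneous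
components of algebra generators. -/
lemma decompose_smul_mem_of_adjoin_eq_top {k R M : Type*} [Field k] [Ring R] [Algebra k R]
    (𝒜 : ℤ → Submodule k R) [GradedAlgebra 𝒜]
    [AddCommGroup M] [Module k M] [Module R M] [IsScalarTower k R M]
    (ℳ : ℤ → Submodule k M) (S : Set R) (hS : Algebra.adjoin k S = ⊤)
    (h : ∀ s ∈ S, ∀ (i j : ℤ), ∀ m ∈ ℳ j, (DirectSum.decompose 𝒜 s i : R) • m ∈ ℳ (i + j))
    (x : R) : ∀ (i j : ℤ), ∀ m ∈ ℳ j, (DirectSum.decompose 𝒜 x i : R) • m ∈ ℳ (i + j) := by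
  classical
  have hx : x ∈ Algebra.adjoin k S := hS ▸ Algebra.mem_top
  induction hx using Algebra.adjoin_induction with
  | mem s hs => exact h s hs
  | algebraMap r =>
    intro i j m hm
    have hr : algebraMap k R r ∈ 𝒜 0 := by
      rw [Algebra.algebraMap_eq_smul_one]
      exact Submodule.smul_mem _ _ SetLike.GradedOne.one_mem
    by_cases hi : i = 0
    · subst hi
      rw [DirectSum.decompose_of_mem_same 𝒜 hr, algebraMap_smul, zero_add]
      exact Submodule.smul_mem _ _ hm
    · rw [DirectSum.decompose_of_mem_ne 𝒜 hr (Ne.symm hi), zero_smul]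
      exact zero_mem _
  | add x y _ _ hx hy =>
    intro i j m hm
    rw [DirectSum.decompose_add, DirectSum.add_apply, Submodule.coe_add, add_smul]
    exact add_mem (hx i j m hm) (hy i j m hm)
  | mul x y _ _ hx hy =>
    intro i j m hm
    rw [DirectSum.decompose_mul, DirectSum.coe_mul_apply, Finset.sum_smul]
    refine sum_mem fun p hp ↦ ?_
    rw [← (Finset.mem_filter.1 hp).2, mul_smul, add_assoc]
    exact hx _ _ _ (hy _ _ _ hm)

/-- A finitely generated graded algebra has finitely many generators whose homogeneous components
live in bounded degrees. -/
lemma exists_generators_bounded_degree {k R : Type*} [Field k] [Ring R] [Algebra k R]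
    (𝒜 : ℤ → Submodule k R) [GradedAlgebra 𝒜] [Algebra.FiniteType k R] :
    ∃ (S : Finset R) (E : ℕ), Algebra.adjoin k (S : Set R) = ⊤ ∧
      ∀ s ∈ S, ∀ e : ℤ, (E : ℤ) < |e| → (DirectSum.decompose 𝒜 s e : R) = 0 := by
  classical
  obtain ⟨S, hS⟩ := Algebra.FiniteType.out (R := k) (A := R)
  refine ⟨S, S.sup fun s ↦ (DirectSum.decompose 𝒜 s).support.sup Int.natAbs, hS, ?_⟩
  intro s hs e he
  by_contra hne
  have he' : e ∈ (DirectSum.decompose 𝒜 s).support := by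
    simpa [DFinsupp.mem_support_iff] using hne
  have h₁ := Finset.le_sup (f := Int.natAbs) he'
  have h₂ := Finset.le_sup
    (f := fun s ↦ (DirectSum.decompose 𝒜 s).support.sup Int.natAbs) hs
  simp only at h₂
  rw [Int.abs_eq_natAbs] at he
  have := h₁.trans h₂
  lia

/-- A module is gradable as soon as it is isomorphic to a twist by a scalar whose order is large
with respect to the degrees of the generators and the dimension. -/
lemma gradable_of_twist {k R M : Type*} [Field k] [IsAlgClosed k] [Ring R] [Algebra k R]
    (𝒜 : ℤ → Submodule k R) [GradedAlgebra 𝒜]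
    [AddCommGroup M] [Module k M] [Module R M] [IsScalarTower k R M] [FiniteDimensional k M]
    (S : Finset R) (E : ℕ) (hS : Algebra.adjoin k (S : Set R) = ⊤)
    (hSE : ∀ s ∈ S, ∀ e : ℤ, (E : ℤ) < |e| → (DirectSum.decompose 𝒜 s e : R) = 0)
    (t : kˣ) (ht : ∀ i : ℕ, 0 < i → i ≤ (finrank k M + 1) * E → t ^ i ≠ 1)
    (ψ : M ≃ₗ[k] M)
    (hψ : ∀ (e : ℤ) (x : R), x ∈ 𝒜 e → ∀ m : M, ψ (x • m) = ((t ^ e : kˣ) : k) • (x • ψ m)) :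
    ∃ ℳ : ℤ → Submodule k M, DirectSum.IsInternal ℳ ∧
      ∀ (i j : ℤ) (x : R) (m : M), x ∈ 𝒜 i → m ∈ ℳ j → x • m ∈ ℳ (i + j) := by
  classical
  let φ : End k M := ψ.toLinearMap
  let Λ : Finset k := φ.charpoly.roots.toFinset
  have hmem : ∀ μ, μ ∈ Λ ↔ φ.HasEigenvalue μ := by
    intro μ
    rw [hasEigenvalue_iff_isRoot_charpoly, Multiset.mem_toFinset,
      Polynomial.mem_roots φ.charpoly_monic.ne_zero]
  have hcard : Λ.card ≤ finrank k M := by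
    rw [← LinearMap.charpoly_natDegree φ]
    exact (Multiset.toFinset_card_le _).trans (Polynomial.card_roots' _)
  have hbot : ∀ μ ∉ Λ, φ.maxGenEigenspace μ = ⊥ := by
    intro μ hμ
    by_contra h
    exact hμ ((hmem μ).2 (HasUnifEigenvalue.lt (k := ⊤) zero_lt_one h))
  have h0 : 0 ∉ Λ := by
    rw [hmem]
    intro h
    obtain ⟨v, hv⟩ := h.exists_hasEigenvector
    have : ψ v = 0 := by simpa [φ] using hv.apply_eq_smul
    exact hv.2 (by simpa using this)
  obtain ⟨f, hf⟩ := exists_degree_of_pow_ne_one Λ h0 t E fun i hi hiE ↦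
    ht i hi (hiE.trans (Nat.mul_le_mul_right _ (by omega)))
  let ℳ : ℤ → Submodule k M := fun j ↦ ⨆ μ ∈ f ⁻¹' {j}, φ.maxGenEigenspace μ
  have hgen : ∀ s ∈ (S : Set R), ∀ (i j : ℤ), ∀ m ∈ ℳ j,
      (DirectSum.decompose 𝒜 s i : R) • m ∈ ℳ (i + j) := by
    intro s hs i j m hm
    rcases lt_or_ge (E : ℤ) |i| with hi | hi
    · rw [hSE s hs i hi, zero_smul]
      exact zero_mem _
    set x : R := (DirectSum.decompose 𝒜 s i : R)
    let g : End k M := Algebra.lsmul k k M x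
    have hg : φ * g = ((t ^ i : kˣ) : k) • (g * φ) :=
      LinearMap.ext fun m ↦ hψ i x (SetLike.coe_mem _) m
    suffices ℳ j ≤ (ℳ (i + j)).comap g from this hm
    refine iSup₂_le fun μ hμ y hy ↦ ?_
    have hgy := mapsTo_maxGenEigenspace_of_mul_eq_smul φ g _ hg μ hy
    by_cases hμΛ : μ ∈ Λ
    · by_cases hμΛ' : ((t ^ i : kˣ) : k) * μ ∈ Λ
      · refine Submodule.mem_iSup_of_mem _ (Submodule.mem_iSup_of_mem ?_ hgy)
        have hμ' : f μ = j := hμ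
        rw [Set.mem_preimage, hf μ hμΛ i hi hμΛ', hμ', add_comm, Set.mem_singleton_iff]
      · rw [hbot _ hμΛ', Submodule.mem_bot] at hgy
        simp [hgy]
    · rw [hbot _ hμΛ, Submodule.mem_bot] at hy
      simp [hy]
  refine ⟨ℳ, isInternal_iSup_fiber _ φ.independent_maxGenEigenspace
    φ.iSup_maxGenEigenspace_eq_top f, fun i j x m hx hm ↦ ?_⟩
  have := decompose_smul_mem_of_adjoin_eq_top 𝒜 ℳ S hS hgen x i j m hm
  rwa [DirectSum.decompose_of_mem_same 𝒜 hx] at this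

/-- In a field, only finitely many units have small order. -/
lemma finite_setOf_pow_eq_one {k : Type*} [Field k] (N : ℕ) :
    {t : kˣ | ∃ i : ℕ, 0 < i ∧ i ≤ N ∧ t ^ i = 1}.Finite := by
  refine ((Set.finite_Icc 1 N).biUnion fun i hi ↦ ?_ :
    (⋃ i ∈ Set.Icc 1 N, {t : kˣ | t ^ i = 1}).Finite).subset ?_
  · have : NeZero i := ⟨by have := hi.1; omega⟩
    have : Finite (rootsOfUnity i k) := inferInstance
    exact (show (rootsOfUnity i k : Set kˣ).Finite from this).subset fun t ht ↦ (mem_rootsOfUnity i t).2 ht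
  · rintro t ⟨i, hi, hiN, hti⟩
    exact Set.mem_biUnion (Set.mem_Icc.2 ⟨hi, hiN⟩) hti

/-- Let `k` be an algebraically closed field, `R` a `ℤ`-graded
`k`-algebra which is finitely generated as a `k`-algebra, and `M` a finite-dimensional
`R`-module.  Then exactly one of the following holds:
(1) the twists `M_α`, `α ∈ kˣ`, are all isomorphic as `R`-modules, and `M` is gradable;
(2) for every `α ∈ kˣ` there are only finitely many `β ∈ kˣ` with `M_α ≅ M_β`, and `M` is
not gradable.
Here an `R`-module isomorphism `M_α → M_β` is encoded as a `k`-linear automorphism `ψ` of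
`M` with `ψ (α^e • (x • m)) = β^e • (x • ψ m)` for all homogeneous `x ∈ 𝒜 e`, and
gradability means a `ℤ`-grading of `M` compatible with that of `R`. -/
theorem twist_dichotomy_gradable_or_parameter_family
    (k : Type*) [Field k] [IsAlgClosed k] (R : Type*) [Ring R] [Algebra k R]
    (𝒜 : ℤ → Submodule k R) [GradedAlgebra 𝒜] [Algebra.FiniteType k R]
    (M : Type*) [AddCommGroup M] [Module k M] [Module R M] [IsScalarTower k R M]
    [FiniteDimensional k M] :
    Xor'
      ((∀ α β : kˣ, ∃ ψ : M ≃ₗ[k] M, ∀ (e : ℤ) (x : R), x ∈ 𝒜 e → ∀ m : M,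
          ψ (((α ^ e : kˣ) : k) • (x • m)) = ((β ^ e : kˣ) : k) • (x • ψ m)) ∧
        (∃ ℳ : ℤ → Submodule k M, DirectSum.IsInternal ℳ ∧
          ∀ (i j : ℤ) (x : R) (m : M), x ∈ 𝒜 i → m ∈ ℳ j → x • m ∈ ℳ (i + j)))
      ((∀ α : kˣ, { β : kˣ | ∃ ψ : M ≃ₗ[k] M, ∀ (e : ℤ) (x : R), x ∈ 𝒜 e → ∀ m : M,
          ψ (((α ^ e : kˣ) : k) • (x • m)) = ((β ^ e : kˣ) : k) • (x • ψ m) }.Finite) ∧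
        ¬ (∃ ℳ : ℤ → Submodule k M, DirectSum.IsInternal ℳ ∧
          ∀ (i j : ℤ) (x : R) (m : M), x ∈ 𝒜 i → m ∈ ℳ j → x • m ∈ ℳ (i + j))) := by
  by_cases hgr : ∃ ℳ : ℤ → Submodule k M, DirectSum.IsInternal ℳ ∧
      ∀ (i j : ℤ) (x : R) (m : M), x ∈ 𝒜 i → m ∈ ℳ j → x • m ∈ ℳ (i + j)
  · refine Or.inl ⟨⟨fun α β ↦ ?_, hgr⟩, fun h ↦ h.2 hgr⟩
    obtain ⟨ℳ, hℳ, hsmul⟩ := hgr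
    exact exists_linearEquiv_twist_of_gradable 𝒜 ℳ hℳ hsmul α β
  · refine Or.inr ⟨⟨fun α ↦ ?_, hgr⟩, fun h ↦ hgr h.2⟩
    obtain ⟨S, E, hS, hSE⟩ := exists_generators_bounded_degree 𝒜
    refine ((finite_setOf_pow_eq_one (k := k) ((finrank k M + 1) * E)).preimage
      (div_left_injective (b := α)).injOn).subset ?_
    rintro β ⟨ψ, hψ⟩
    by_contra ht
    simp only [Set.mem_preimage, Set.mem_ofPred_eq, not_exists, not_and] at ht
    refine hgr (gradable_of_twist 𝒜 S E hS hSE (β / α) ht ψ fun e x hx m ↦ ?_)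
    have h := congrArg (fun y ↦ ((α ^ e : kˣ)⁻¹ : kˣ) • y) (hψ e x hx m)
    simp only [map_smul, Units.smul_def, smul_smul, ← Units.val_mul] at h
    simpa [div_zpow, div_eq_inv_mul, mul_zpow] using h
end

section
/- Let k be an algebraically closed field, R a ℤ-graded k-algebra which is finitely generated as a k-algebra, and M a finite-dimensional left R-module such that Ext¹_R(M, M) = 0, i.e. every short exact sequence of R-modules 0 → M → E → M → 0 splits. Then M is gradable. -/
universe u v

universe w

/-- A sequence can be built term by term when each condition only involves earlier terms. -/
lemma exists_seq_of_forall_exists_update {α : Type*} [Nonempty α] (P : ℕ → (ℕ → α) → Prop)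
    (hloc : ∀ n f g, (∀ b ≤ n, f b = g b) → P n f → P n g)
    (hstep : ∀ n f, (∀ b < n, P b f) → ∃ x, P n (Function.update f n x)) :
    ∃ f, ∀ n, P n f := by
  classical
  have hnext : ∀ n (F : {f : ℕ → α // ∀ b < n, P b f}),
      ∃ x, ∀ b < n + 1, P b (Function.update F.1 n x) := by
    rintro n ⟨f, hf⟩
    obtain ⟨x, hx⟩ := hstep n f hf
    refine ⟨x, fun b hb => ?_⟩
    rcases Nat.lt_succ_iff_lt_or_eq.mp hb with h | rfl
    · refine hloc b f _ (fun c hc => ?_) (hf b h)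
      rw [Function.update_of_ne (by lia)]
    · exact hx
  choose x hx using hnext
  let F : ∀ n, {f : ℕ → α // ∀ b < n, P b f} := fun n =>
    Nat.rec ⟨fun _ => Classical.arbitrary α, by simp⟩
      (fun n F => ⟨Function.update F.1 n (x n F), hx n F⟩) n
  have hF : ∀ n, (F (n + 1)).1 = Function.update (F n).1 n (x n (F n)) := fun n => rfl
  have hstab : ∀ b d, (F (b + 1 + d)).1 b = (F (b + 1)).1 b := by
    intro b d
    induction d with
    | zero => rfl
    | succ d ih => rw [← add_assoc, hF, Function.update_of_ne (by lia), ih]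
  refine ⟨fun n => (F (n + 1)).1 n, fun n => ?_⟩
  refine hloc n (F (n + 1)).1 _ (fun b hb => ?_) ((F (n + 1)).2 n n.lt_succ_self)
  obtain ⟨d, rfl⟩ := Nat.exists_eq_add_of_le hb
  rw [show b + d + 1 = b + 1 + d by ring, hstab]

/-- A function on a field that increases by one under multiplication by a non-torsion element. -/
lemma exists_int_shift {L : Type*} [Field L] (u : L) (hu0 : u ≠ 0)
    (hu : ∀ i : ℤ, u ^ i = 1 → i = 0) :
    ∃ f : L → ℤ, ∀ μ, μ ≠ 0 → ∀ i : ℤ, f (u ^ i * μ) = f μ + i := by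
  let S : Setoid L :=
    { r := fun μ ν => ∃ i : ℤ, μ = u ^ i * ν
      iseqv :=
        { refl := fun μ => ⟨0, by simp⟩
          symm := by
            rintro μ ν ⟨i, rfl⟩
            exact ⟨-i, by rw [← mul_assoc, ← zpow_add₀ hu0]; simp⟩
          trans := by
            rintro a b c ⟨i, rfl⟩ ⟨j, rfl⟩
            exact ⟨i + j, by rw [zpow_add₀ hu0, mul_assoc]⟩ } }
  have hrep : ∀ μ : L, ∃ i : ℤ, μ = u ^ i * (Quotient.mk S μ).out := fun μ =>
    S.symm (Quotient.mk_out μ)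
  choose f hf using hrep
  refine ⟨f, fun μ hμ i => ?_⟩
  have hq : Quotient.mk S (u ^ i * μ) = Quotient.mk S μ := Quotient.sound ⟨i, rfl⟩
  have h1 := hf (u ^ i * μ)
  rw [hq] at h1
  have h2 := hf μ
  set ν := (Quotient.mk S μ).out
  have hν : ν ≠ 0 := by
    rintro h
    rw [h, mul_zero] at h2
    exact hμ h2
  have h3 : u ^ (f (u ^ i * μ) - (f μ + i)) = 1 := by
    have h4 : u ^ (f (u ^ i * μ)) * ν = u ^ (f μ + i) * ν := by
      rw [← h1, zpow_add₀ hu0, mul_comm (u ^ f μ), mul_assoc, ← h2]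
    rw [zpow_sub₀ hu0, mul_right_cancel₀ hν h4, div_self (zpow_ne_zero _ hu0)]
  have := hu _ h3
  lia

/-- A nontrivial commutative algebra of finite type over an algebraically closed field has a
rational point. -/
lemma exists_algHom_of_finiteType (k A : Type*) [Field k] [IsAlgClosed k] [CommRing A]
    [Nontrivial A] [Algebra k A] [Algebra.FiniteType k A] : Nonempty (A →ₐ[k] k) := by
  have hfield (F : Type _) [Field F] [Algebra k F] [Algebra.FiniteType k F] :
      Nonempty (F →ₐ[k] k) := by
    have : Module.Finite k F := finite_of_finite_type_of_isJacobsonRing _ _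
    have : Algebra.IsIntegral k F := Algebra.IsIntegral.of_finite k F
    exact ⟨((AlgEquiv.ofBijective (Algebra.ofId k F)
      IsAlgClosed.algebraMap_bijective_of_isIntegral).symm : F →ₐ[k] k)⟩
  obtain ⟨m, hm⟩ := Ideal.exists_maximal A
  let := Ideal.Quotient.field m
  have : Algebra.FiniteType k (A ⧸ m) :=
    Algebra.FiniteType.of_surjective (Ideal.Quotient.mkₐ k m) (Ideal.Quotient.mkₐ_surjective k m)
  obtain ⟨g⟩ := hfield (A ⧸ m)
  exact ⟨g.comp (Ideal.Quotient.mkₐ k m)⟩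

/-- The projections attached to a finite internal direct sum decomposition. -/
lemma DirectSum.IsInternal.exists_projections {L W ι : Type*} [Field L] [AddCommGroup W]
    [Module L W] [Fintype ι] [DecidableEq ι] {V : ι → Submodule L W}
    (hV : DirectSum.IsInternal V) :
    ∃ p : ι → Module.End L W, ∑ s, p s = 1 ∧ (∀ s v, p s v ∈ V s) ∧
      (∀ s, ∀ v ∈ V s, p s v = v) ∧ ∀ s t, s ≠ t → ∀ v ∈ V s, p t v = 0 := by
  classical
  let := hV.chooseDecomposition
  refine ⟨fun s => (V s).subtype ∘ₗ DirectSum.component L ι (fun i => V i) s ∘ₗ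
    (DirectSum.decomposeLinearEquiv V).toLinearMap, ?_, ?_, ?_, ?_⟩
  · ext v
    rw [LinearMap.sum_apply]
    change ∑ s, (DirectSum.decompose V v s : W) = v
    conv_rhs => rw [← DirectSum.sum_support_decompose V v]
    refine (Finset.sum_subset (Finset.subset_univ _) fun s _ hs => ?_).symm
    rw [DFinsupp.notMem_support_iff.mp hs, Submodule.coe_zero]
  · intro s v
    exact Subtype.property _
  · intro s v hv
    exact DirectSum.decompose_of_mem_same V hv
  · intro s t hst v hv
    exact DirectSum.decompose_of_mem_ne V hv hst

open PowerSeries in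
/-- The matrix of `m`-th coefficients of a matrix of power series. -/
noncomputable def coeffMatrix (k : Type*) (n : Type*) [Field k] (m : ℕ) :
    Matrix n n k⟦X⟧ →ₗ[k] Matrix n n k :=
  LinearMap.mapMatrix (PowerSeries.coeff m)

open PowerSeries in
/-- A matrix, seen as a constant matrix of power series. -/
noncomputable def constMatrix (k : Type*) (n : Type*) [Field k] [Fintype n] [DecidableEq n] :
    Matrix n n k →ₐ[k] Matrix n n k⟦X⟧ :=
  (Algebra.ofId k k⟦X⟧).mapMatrix

open PowerSeries in
/-- The matrix of power series with prescribed coefficients. -/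
noncomputable def mkMatrix {k : Type*} {n : Type*} [Field k] (f : ℕ → Matrix n n k) :
    Matrix n n k⟦X⟧ :=
  Matrix.of fun i j => PowerSeries.mk fun m => f m i j

section

open PowerSeries

variable {k n R : Type*} [Field k]

lemma coeffMatrix_apply (m : ℕ) (A : Matrix n n k⟦X⟧) (i j : n) :
    coeffMatrix k n m A i j = PowerSeries.coeff m (A i j) := rfl

lemma coeffMatrix_mkMatrix (f : ℕ → Matrix n n k) (m : ℕ) :
    coeffMatrix k n m (mkMatrix f) = f m := by
  ext i j
  simp [coeffMatrix_apply, mkMatrix]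

lemma matrix_powerSeries_ext {A B : Matrix n n k⟦X⟧}
    (h : ∀ m, coeffMatrix k n m A = coeffMatrix k n m B) : A = B := by
  ext i j m
  exact congrFun (congrFun (h m) i) j

variable [Fintype n]

lemma coeffMatrix_mul (m : ℕ) (A B : Matrix n n k⟦X⟧) :
    coeffMatrix k n m (A * B) =
      ∑ p ∈ Finset.HasAntidiagonal.antidiagonal m, coeffMatrix k n p.1 A * coeffMatrix k n p.2 B := by
  ext i j
  simp only [coeffMatrix_apply, Matrix.mul_apply, map_sum, PowerSeries.coeff_mul,
    Matrix.sum_apply]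
  exact Finset.sum_comm

variable [DecidableEq n] [Ring R] [Algebra k R]

lemma constMatrix_apply (A : Matrix n n k) (i j : n) :
    constMatrix k n A i j = PowerSeries.C (A i j) := rfl

lemma coeffMatrix_mul_const (m : ℕ) (A : Matrix n n k⟦X⟧) (B : Matrix n n k) :
    coeffMatrix k n m (A * constMatrix k n B) = coeffMatrix k n m A * B := by
  ext i j
  simp [coeffMatrix_apply, Matrix.mul_apply, constMatrix_apply]

lemma coeffMatrix_mul_of_lt {m : ℕ} (A B : Matrix n n k⟦X⟧)
    (hB : ∀ b < m, coeffMatrix k n b B = 0) :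
    coeffMatrix k n m (A * B) = coeffMatrix k n 0 A * coeffMatrix k n m B := by
  rw [coeffMatrix_mul, Finset.sum_eq_single (0, m)]
  · rintro ⟨a, b⟩ hab hne
    rw [Finset.HasAntidiagonal.mem_antidiagonal] at hab
    rw [hB b, mul_zero]
    by_contra hlt
    apply hne
    rw [Prod.mk.injEq]
    lia
  · simp

/-- If all derivations into `Matrix n n k` are inner, every formal deformation of a matrix
representation is conjugate to the constant one. -/
lemma exists_conj_of_inner (ρ : R →ₐ[k] Matrix n n k)
    (hinner : ∀ D : R →ₗ[k] Matrix n n k, (∀ x y, D (x * y) = ρ x * D y + D x * ρ y) →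
      ∃ b, ∀ x, D x = b * ρ x - ρ x * b)
    (φ : R →ₐ[k] Matrix n n k⟦X⟧) (hφ : ∀ x, coeffMatrix k n 0 (φ x) = ρ x) :
    ∃ G : Matrix n n k⟦X⟧, coeffMatrix k n 0 G = 1 ∧
      ∀ x, φ x * G = G * constMatrix k n (ρ x) := by
  let T : (ℕ → Matrix n n k) → R → Matrix n n k⟦X⟧ := fun f x =>
    φ x * mkMatrix f - mkMatrix f * constMatrix k n (ρ x)
  have hT : ∀ m f x, coeffMatrix k n m (T f x) =
      ∑ p ∈ Finset.HasAntidiagonal.antidiagonal m, coeffMatrix k n p.1 (φ x) * f p.2 - f m * ρ x := by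
    intro m f x
    rw [map_sub, coeffMatrix_mul_const, coeffMatrix_mul]
    simp only [coeffMatrix_mkMatrix]
  obtain ⟨f, hf⟩ := exists_seq_of_forall_exists_update
    (fun m f => (m = 0 → f 0 = 1) ∧ ∀ x, coeffMatrix k n m (T f x) = 0) (by
      rintro m f g hfg ⟨h0, h⟩
      refine ⟨fun hm => by rw [← hfg 0 (by lia), h0 hm], fun x => ?_⟩
      rw [← h x, hT, hT, hfg m le_rfl]
      congr 1
      refine Finset.sum_congr rfl fun p hp => ?_
      rw [Finset.HasAntidiagonal.mem_antidiagonal] at hp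
      rw [hfg p.2 (by lia)]) (by
      intro m f hf
      rcases Nat.eq_zero_or_pos m with rfl | hm
      · refine ⟨1, fun _ => by simp, fun x => ?_⟩
        rw [hT]
        simp [hφ]
      let D : R →ₗ[k] Matrix n n k :=
        coeffMatrix k n m ∘ₗ
          (LinearMap.mulRight k (mkMatrix f) ∘ₗ φ.toLinearMap -
            LinearMap.mulLeft k (mkMatrix f) ∘ₗ (constMatrix k n).toLinearMap ∘ₗ ρ.toLinearMap)
      have hD : ∀ x, D x = coeffMatrix k n m (T f x) := fun x => rfl
      obtain ⟨b, hb⟩ := hinner D (by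
        intro x y
        have hxy : T f (x * y) = φ x * T f y + T f x * constMatrix k n (ρ y) := by
          simp only [T, map_mul]
          noncomm_ring
        rw [hD, hxy, map_add, coeffMatrix_mul_const,
          coeffMatrix_mul_of_lt _ _ fun b hb => (hf b hb).2 y, hφ, hD, hD])
      refine ⟨f m + b, fun h => absurd h hm.ne', fun x => ?_⟩
      have hupd : Function.update f m (f m + b) = f + Pi.single m b := by
        ext1 c
        by_cases hc : c = m
        · subst hc
          simp
        · simp [hc]
      have hsum : ∑ p ∈ Finset.HasAntidiagonal.antidiagonal m,
          coeffMatrix k n p.1 (φ x) * (Pi.single m b : ℕ → Matrix n n k) p.2 = ρ x * b := by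
        rw [Finset.sum_eq_single (0, m)]
        · simp [hφ]
        · rintro ⟨a, c⟩ hac hne
          rw [Finset.HasAntidiagonal.mem_antidiagonal] at hac
          rw [Pi.single_eq_of_ne, mul_zero]
          rintro rfl
          apply hne
          rw [Prod.mk.injEq]
          lia
        · simp
      have h1 := hb x
      rw [hD, hT] at h1
      rw [hT, hupd]
      simp only [Pi.add_apply, mul_add, Finset.sum_add_distrib, hsum, Pi.single_eq_same, add_mul]
      rw [← sub_eq_zero] at h1
      rw [← h1]
      abel)
  refine ⟨mkMatrix f, ?_, fun x => ?_⟩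
  · rw [coeffMatrix_mkMatrix]
    exact (hf 0).1 rfl
  · rw [← sub_eq_zero]
    exact matrix_powerSeries_ext fun m => by rw [(hf m).2 x, map_zero]

/-- The deformation of a matrix representation of a `ℤ`-graded algebra obtained by letting the
unit `u` act on the degree. -/
lemma exists_graded_twist (𝒜 : ℤ → Submodule k R) [GradedAlgebra 𝒜] (ρ : R →ₐ[k] Matrix n n k)
    (u : k⟦X⟧ˣ) :
    ∃ φ : R →ₐ[k] Matrix n n k⟦X⟧, ∀ i, ∀ x ∈ 𝒜 i,
      φ x = ((u ^ i : k⟦X⟧ˣ) : k⟦X⟧) • constMatrix k n (ρ x) := by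
  let f : ∀ i, 𝒜 i →ₗ[k] Matrix n n k⟦X⟧ := fun i =>
    ((u ^ i : k⟦X⟧ˣ) : k⟦X⟧) •
      ((constMatrix k n).toLinearMap ∘ₗ ρ.toLinearMap ∘ₗ (𝒜 i).subtype)
  have hfa : ∀ i (x : 𝒜 i), f i x = ((u ^ i : k⟦X⟧ˣ) : k⟦X⟧) • constMatrix k n (ρ x) :=
    fun i x => rfl
  let ψ := DirectSum.toAlgebra k (fun i => 𝒜 i) f
    (by
      change ((u ^ (0 : ℤ) : k⟦X⟧ˣ) : k⟦X⟧) • constMatrix k n (ρ 1) = 1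
      simp)
    (by
      intro i j a b
      change ((u ^ (i + j) : k⟦X⟧ˣ) : k⟦X⟧) • constMatrix k n (ρ (a * b)) = _
      rw [hfa, hfa, map_mul, map_mul, zpow_add, Units.val_mul, smul_mul_smul_comm])
  refine ⟨ψ.comp (DirectSum.decomposeAlgEquiv 𝒜).toAlgHom, fun i x hx => ?_⟩
  have h1 : DirectSum.decomposeAlgEquiv 𝒜 x = DirectSum.of (fun i => 𝒜 i) i ⟨x, hx⟩ :=
    DirectSum.decompose_of_mem 𝒜 hx
  change ψ (DirectSum.decomposeAlgEquiv 𝒜 x) = _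
  rw [h1]
  exact DirectSum.toAddMonoid_of (fun i => (f i).toAddMonoidHom) i ⟨x, hx⟩

end

/-- If `a` intertwines `g` with `c • g`, it rescales the generalized eigenvalues of `g` by `c`. -/
lemma mem_maxGenEigenspace_mul {L W : Type*} [Field L] [AddCommGroup W] [Module L W]
    {g a : Module.End L W} {c : L} (h : (c • a) * g = g * a) {μ : L} {v : W}
    (hv : v ∈ g.maxGenEigenspace μ) : a v ∈ g.maxGenEigenspace (c * μ) := by
  rw [Module.End.mem_maxGenEigenspace] at hv ⊢
  obtain ⟨m, hm⟩ := hv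
  refine ⟨m, ?_⟩
  have h1 : (g - (c * μ) • 1) * a = (c • a) * (g - μ • 1) := by
    rw [sub_mul, mul_sub, h]
    simp [smul_smul, mul_comm]
  have h2 : ∀ m : ℕ, (g - (c * μ) • 1) ^ m * a = (c ^ m • a) * (g - μ • 1) ^ m := by
    intro m
    induction m with
    | zero => simp
    | succ m ih =>
      rw [pow_succ', mul_assoc, ih, smul_mul_assoc, mul_smul_comm, ← mul_assoc, h1,
        pow_succ' (g - μ • 1), pow_succ, smul_mul_assoc, smul_mul_assoc, smul_mul_assoc, mul_smul,
        mul_assoc]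
  have h3 := LinearMap.congr_fun (h2 m) v
  rw [Module.End.mul_apply, Module.End.mul_apply, hm, map_zero] at h3
  exact h3

/-- An automorphism `g` and a non-torsion scalar `u` produce a finite family of projections
graded by the integers, such that an operator `a` with `u ^ i • a * g = g * a` has degree `i`. -/
lemma exists_graded_projections {L : Type w} {W : Type*} [Field L] [IsAlgClosed L] [AddCommGroup W]
    [Module L W] [FiniteDimensional L W] (g : Module.End L W) (hg : Function.Injective g)
    (u : L) (hu0 : u ≠ 0) (hu : ∀ i : ℤ, u ^ i = 1 → i = 0) :
    ∃ (ι : Type w) (_ : Fintype ι) (p : ι → Module.End L W) (f : ι → ℤ), ∑ s, p s = 1 ∧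
      ∀ (i : ℤ) (a : Module.End L W), (u ^ i • a) * g = g * a →
        ∀ s t, f t ≠ f s + i → p t * a * p s = 0 := by
  classical
  obtain ⟨f, hf⟩ := exists_int_shift u hu0 hu
  have hdirect : DirectSum.IsInternal g.maxGenEigenspace :=
    (DirectSum.isInternal_submodule_iff_iSupIndep_and_iSup_eq_top _).2
      ⟨g.independent_maxGenEigenspace, g.iSup_maxGenEigenspace_eq_top⟩
  let ι := {μ : L // g.maxGenEigenspace μ ≠ ⊥}
  have hfin : Finite ι :=
    WellFoundedGT.finite_ne_bot_of_iSupIndep g.independent_maxGenEigenspace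
  have : Fintype ι := Fintype.ofFinite ι
  have hdirect' : DirectSum.IsInternal fun s : ι => g.maxGenEigenspace s :=
    DirectSum.isInternal_ne_bot_iff.2 hdirect
  obtain ⟨p, hsum, hmem, -, hzero⟩ := hdirect'.exists_projections
  refine ⟨ι, this, p, fun s => f s, hsum, fun i a ha s t hst => ?_⟩
  ext v
  have h1 := mem_maxGenEigenspace_mul ha (hmem s v)
  have hs : (s : L) ≠ 0 := by
    intro h0
    apply s.2
    rw [h0, eq_bot_iff]
    intro w hw
    obtain ⟨m, hm⟩ := (Module.End.mem_maxGenEigenspace _ _ _).1 hw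
    rw [zero_smul, sub_zero, Module.End.coe_pow] at hm
    exact (hg.iterate m) (by rw [hm, ← Module.End.coe_pow, map_zero])
  change p t (a (p s v)) = 0
  by_cases hb : g.maxGenEigenspace (u ^ i * s) = ⊥
  · rw [hb, Submodule.mem_bot] at h1
    rw [h1, map_zero]
  · refine hzero ⟨u ^ i * s, hb⟩ t ?_ _ h1
    rintro rfl
    exact hst (hf s hs i)

/-- Finite families of idempotent-like matrices satisfying `k`-linear vanishing conditions over an
extension of an algebraically closed field `k` can be specialised to `k`. -/
lemma exists_specialization {k L n ι R : Type*} [Field k] [IsAlgClosed k] [Field L] [Algebra k L]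
    [Fintype n] [DecidableEq n] [Fintype ι] (p : ι → Matrix n n L) (hp : ∑ s, p s = 1)
    (ρ : R → Matrix n n k) :
    ∃ q : ι → Matrix n n k, ∑ s, q s = 1 ∧
      ∀ x s t, p t * (Algebra.ofId k L).mapMatrix (ρ x) * p s = 0 → q t * ρ x * q s = 0 := by
  classical
  let S : Finset L := Finset.univ.image fun z : ι × n × n => p z.1 z.2.1 z.2.2
  let A := Algebra.adjoin k (S : Set L)
  have : Algebra.FiniteType k A :=
    (Subalgebra.fg_iff_finiteType _).1 (Subalgebra.fg_adjoin_finset S)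
  obtain ⟨ψ⟩ := exists_algHom_of_finiteType k A
  let P : ι → Matrix n n A := fun s => Matrix.of fun i j =>
    ⟨p s i j, Algebra.subset_adjoin (by
      simp only [S, Finset.coe_image, Finset.coe_univ, Set.image_univ]
      exact ⟨(s, i, j), rfl⟩)⟩
  have hP : ∀ s, A.val.mapMatrix (P s) = p s := fun s => rfl
  have hinj : Function.Injective (A.val.mapMatrix : Matrix n n A →ₐ[k] Matrix n n L) := by
    intro X Y h
    ext i j
    exact congrFun (congrFun h i) j
  have hcomp : ∀ m : Matrix n n k,
      A.val.mapMatrix ((Algebra.ofId k A).mapMatrix m) = (Algebra.ofId k L).mapMatrix m :=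
    fun m => rfl
  have hψ : ∀ m : Matrix n n k, ψ.mapMatrix ((Algebra.ofId k A).mapMatrix m) = m := by
    intro m
    ext i j
    exact ψ.commutes (m i j)
  refine ⟨fun s => ψ.mapMatrix (P s), ?_, fun x s t h => ?_⟩
  · rw [← map_sum, ← map_one ψ.mapMatrix]
    congr 1
    apply hinj
    rw [map_sum, map_one, ← hp]
    rfl
  · rw [← hψ (ρ x), ← map_mul, ← map_mul, ← map_zero ψ.mapMatrix]
    congr 1
    apply hinj
    rw [map_mul, map_mul, hP, hP, hcomp, h, map_zero]

/-- A finite family of operators, indexed with integer degrees and summing to the identity, defines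
a grading as soon as the graded algebra acts compatibly with the degrees. -/
lemma gradable_of_projections {k R M ι : Type*} [Field k] [Ring R] [Algebra k R]
    (𝒜 : ℤ → Submodule k R) [GradedAlgebra 𝒜] [AddCommGroup M] [Module k M] [Module R M]
    [Fintype ι] (p : ι → Module.End k M) (f : ι → ℤ) (hsum : ∑ s, p s = 1)
    (hp : ∀ i, ∀ x ∈ 𝒜 i, ∀ s t, f t ≠ f s + i → ∀ m, p t (x • p s m) = 0) :
    ∃ ℳ : ℤ → Submodule k M, DirectSum.IsInternal ℳ ∧
      ∀ (i j : ℤ) (x : R) (m : M), x ∈ 𝒜 i → m ∈ ℳ j → x • m ∈ ℳ (i + j) := by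
  have hm : ∀ m, m = ∑ s, p s m := fun m => by
    rw [← LinearMap.sum_apply, hsum, Module.End.one_apply]
  let ℳ : ℤ → Submodule k M := fun j => ⨅ s, ⨅ _ : f s ≠ j, LinearMap.ker (p s)
  have hmem : ∀ j m, m ∈ ℳ j ↔ ∀ s, f s ≠ j → p s m = 0 := by
    intro j m
    simp [ℳ, Submodule.mem_iInf]
  refine ⟨ℳ, ?_, ?_⟩
  · rw [DirectSum.isInternal_submodule_iff_iSupIndep_and_iSup_eq_top]
    constructor
    · intro j
      rw [Submodule.disjoint_def]
      intro m hmj hm'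
      rw [hm m]
      refine Finset.sum_eq_zero fun s _ => ?_
      by_cases hs : f s = j
      · have hle : (⨆ i, ⨆ _ : i ≠ j, ℳ i) ≤ LinearMap.ker (p s) := by
          refine iSup_le fun i => iSup_le fun hi y hy => ?_
          exact (hmem i y).1 hy s (by rw [hs]; exact hi.symm)
        exact hle hm'
      · exact (hmem j m).1 hmj s hs
    · rw [eq_top_iff]
      intro m _
      rw [hm m]
      refine Submodule.sum_mem _ fun s _ => Submodule.mem_iSup_of_mem (f s) ?_
      rw [hmem]
      intro t ht
      have := hp 0 1 SetLike.GradedOne.one_mem s t (by simpa using ht) m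
      rwa [one_smul] at this
  · intro i j x m hx hmj
    rw [hmem] at hmj ⊢
    intro t ht
    rw [hm m, Finset.smul_sum, map_sum]
    refine Finset.sum_eq_zero fun s _ => ?_
    by_cases hs : f s = j
    · exact hp i x hx s t (by rw [hs, add_comm]; exact ht) m
    · rw [hmj s hs, smul_zero, map_zero]

/-- The underlying group of an extension of `M` by itself. -/
def SelfExtension (M : Type*) : Type _ := M × M

instance (M : Type*) [AddCommGroup M] : AddCommGroup (SelfExtension M) :=
  inferInstanceAs (AddCommGroup (M × M))

/-- If every self-extension of `M` splits, every derivation into `Module.End k M` is inner. -/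
lemma exists_eq_commutator_of_rigid {k : Type*} {R M : Type v} [Field k] [Ring R] [Algebra k R]
    [AddCommGroup M] [Module k M] [Module R M] [IsScalarTower k R M]
    (hext : ∀ (E : Type v) [AddCommGroup E] [Module R E]
      (ι : M →ₗ[R] E) (π : E →ₗ[R] M),
      Function.Injective ι → Function.Surjective π →
      LinearMap.range ι = LinearMap.ker π →
      ∃ s : M →ₗ[R] E, π.comp s = LinearMap.id)
    (D : R →ₗ[k] Module.End k M)
    (hD : ∀ x y m, D (x * y) m = x • D y m + D x (y • m)) :
    ∃ b : Module.End k M, ∀ x m, D x m = b (x • m) - x • b m := by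
  have hD1 : D 1 = 0 := by
    ext m
    have := hD 1 1 m
    simpa using this
  let : Module R (SelfExtension M) :=
    { smul := fun x e => (x • e.1 + D x e.2, x • e.2)
      one_smul := fun e => by
        change ((1 : R) • e.1 + D 1 e.2, (1 : R) • e.2) = e
        simp only [hD1, one_smul, LinearMap.zero_apply, add_zero]
        rfl
      mul_smul := fun x y e => by
        change ((x * y) • e.1 + D (x * y) e.2, (x * y) • e.2) =
          (x • (y • e.1 + D y e.2) + D x (y • e.2), x • y • e.2)
        rw [hD, mul_smul, mul_smul, smul_add, add_assoc]
      smul_zero := fun x => by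
        change (x • (0 : M) + D x 0, x • (0 : M)) = (0, 0)
        simp
      smul_add := fun x e e' => by
        change (x • (e.1 + e'.1) + D x (e.2 + e'.2), x • (e.2 + e'.2)) =
          (x • e.1 + D x e.2 + (x • e'.1 + D x e'.2), x • e.2 + x • e'.2)
        rw [smul_add, smul_add, map_add, add_add_add_comm]
      add_smul := fun x y e => by
        change ((x + y) • e.1 + D (x + y) e.2, (x + y) • e.2) =
          (x • e.1 + D x e.2 + (y • e.1 + D y e.2), x • e.2 + y • e.2)
        rw [add_smul, add_smul, map_add, LinearMap.add_apply, add_add_add_comm]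
      zero_smul := fun e => by
        change ((0 : R) • e.1 + D 0 e.2, (0 : R) • e.2) = (0, 0)
        simp }
  have hsmul : ∀ (x : R) (e : SelfExtension M),
      x • e = ((x • e.1 + D x e.2, x • e.2) : M × M) := fun x e => rfl
  let incl : M →ₗ[R] SelfExtension M :=
    { toFun := fun m => ((m, 0) : M × M)
      map_add' := fun m m' => by
        change (m + m', (0 : M)) = (m + m', 0 + 0)
        rw [add_zero]
      map_smul' := fun x m => by
        change ((x • m, 0) : M × M) = (x • m + D x 0, x • (0 : M))
        rw [map_zero, smul_zero, add_zero] }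
  let proj : SelfExtension M →ₗ[R] M :=
    { toFun := fun e => e.2
      map_add' := fun e e' => rfl
      map_smul' := fun x e => rfl }
  obtain ⟨s, hs⟩ := hext (SelfExtension M) incl proj
    (fun m m' h => congrArg Prod.fst h) (fun m => ⟨((0, m) : M × M), rfl⟩) (by
      ext e
      constructor
      · rintro ⟨m, rfl⟩
        rfl
      · intro he
        exact ⟨e.1, Prod.ext rfl (Eq.symm he)⟩)
  have hs2 : ∀ m, (s m).2 = m := fun m => LinearMap.congr_fun hs m
  have hs1 : ∀ (x : R) m, (s (x • m)).1 = x • (s m).1 + D x m := by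
    intro x m
    rw [map_smul]
    change x • (s m).1 + D x (s m).2 = _
    rw [hs2]
  refine ⟨{ toFun := fun m => (s m).1
            map_add' := fun m m' => by rw [map_add]; rfl
            map_smul' := fun c m => ?_ }, fun x m => ?_⟩
  · have := hs1 (algebraMap k R c) m
    rwa [Algebra.algebraMap_eq_smul_one, D.map_smul, hD1, smul_zero, LinearMap.zero_apply,
      add_zero, smul_one_smul, smul_one_smul] at this
  · change D x m = (s (x • m)).1 - x • (s m).1
    rw [hs1, add_sub_cancel_left]

open PowerSeries in
lemma one_add_X_zpow_eq_one {k : Type*} [Field k] {u : k⟦X⟧ˣ} (hu : (u : k⟦X⟧) = 1 + X) {i : ℤ}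
    (h : u ^ i = 1) : i = 0 := by
  have key : ∀ m : ℕ, u ^ m = 1 → m = 0 := by
    intro m hm
    have h1 : ((1 + Polynomial.X : Polynomial k) ^ m : Polynomial k) = 1 := by
      apply Polynomial.coe_injective k
      rw [Polynomial.coe_pow, Polynomial.coe_add, Polynomial.coe_one, Polynomial.coe_X, ← hu,
        ← Units.val_pow_eq_pow_val, hm, Units.val_one]
    have h2 := congrArg Polynomial.natDegree h1
    rw [add_comm, ← Polynomial.C_1, Polynomial.natDegree_pow, Polynomial.natDegree_X_add_C,
      Polynomial.natDegree_C, mul_one] at h2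
    exact h2
  obtain ⟨m, rfl | rfl⟩ := i.eq_nat_or_neg
  · rw [key m (by simpa using h), Nat.cast_zero]
  · rw [key m (by simpa using h), Nat.cast_zero, neg_zero]

open PowerSeries in
/-- A matrix representation of a `ℤ`-graded algebra all of whose derivations are inner admits, over
`k`, a finite family of matrices cutting out a grading. -/
lemma exists_graded_matrices {k : Type u} {n R : Type*} [Field k] [IsAlgClosed k] [Fintype n]
    [DecidableEq n] [Ring R] [Algebra k R] (𝒜 : ℤ → Submodule k R) [GradedAlgebra 𝒜]
    (ρ : R →ₐ[k] Matrix n n k)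
    (hinner : ∀ D : R →ₗ[k] Matrix n n k, (∀ x y, D (x * y) = ρ x * D y + D x * ρ y) →
      ∃ b, ∀ x, D x = b * ρ x - ρ x * b) :
    ∃ (ι : Type u) (_ : Fintype ι) (q : ι → Matrix n n k) (f : ι → ℤ), ∑ s, q s = 1 ∧
      ∀ i, ∀ x ∈ 𝒜 i, ∀ s t, f t ≠ f s + i → q t * ρ x * q s = 0 := by
  obtain ⟨u, hu⟩ : IsUnit (1 + X : k⟦X⟧) := by
    rw [PowerSeries.isUnit_iff_constantCoeff]
    simp
  obtain ⟨φ, hφ⟩ := exists_graded_twist 𝒜 ρ u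
  have hu1 : ∀ i : ℤ, constantCoeff ((u ^ i : k⟦X⟧ˣ) : k⟦X⟧) = 1 := by
    intro i
    have h1 : Units.map (constantCoeff (R := k)).toMonoidHom u = 1 := by
      ext
      simp [hu]
    have h2 := congrArg Units.val (map_zpow (Units.map (constantCoeff (R := k)).toMonoidHom) u i)
    rw [h1, one_zpow] at h2
    exact h2
  have hφ0 : ∀ x, coeffMatrix k n 0 (φ x) = ρ x := by
    intro x
    induction x using DirectSum.Decomposition.inductionOn 𝒜 with
    | zero => simp
    | @homogeneous i a =>
      rw [hφ i a a.2]
      ext r s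
      rw [coeffMatrix_apply, Matrix.smul_apply, smul_eq_mul, constMatrix_apply,
        coeff_zero_eq_constantCoeff_apply, map_mul, hu1, constantCoeff_C, one_mul]
    | add a b ha hb => rw [map_add, map_add, map_add, ha, hb]
  obtain ⟨G, hG0, hG⟩ := exists_conj_of_inner ρ hinner φ hφ0
  have hdet : IsUnit G.det := by
    rw [PowerSeries.isUnit_iff_constantCoeff, RingHom.map_det]
    have : (constantCoeff (R := k)).mapMatrix G = 1 := by
      rw [← hG0]
      ext r s
      rw [coeffMatrix_apply, coeff_zero_eq_constantCoeff_apply]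
      rfl
    rw [this, Matrix.det_one]
    exact isUnit_one
  let L := AlgebraicClosure (FractionRing k⟦X⟧)
  let j : k⟦X⟧ →ₐ[k] L := IsScalarTower.toAlgHom k k⟦X⟧ L
  have hj : Function.Injective j := by
    have : Function.Injective (algebraMap k⟦X⟧ L) := by
      rw [IsScalarTower.algebraMap_eq k⟦X⟧ (FractionRing k⟦X⟧) L]
      exact (algebraMap (FractionRing k⟦X⟧) L).injective.comp (IsFractionRing.injective _ _)
    exact this
  let uL : Lˣ := Units.map j.toRingHom.toMonoidHom u
  have huL : ∀ i : ℤ, ((uL : L)) ^ i = j ((u ^ i : k⟦X⟧ˣ) : k⟦X⟧) := by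
    intro i
    rw [← Units.val_zpow_eq_zpow_val]
    exact (congrArg Units.val (map_zpow (Units.map j.toRingHom.toMonoidHom) u i)).symm
  have htors : ∀ i : ℤ, (uL : L) ^ i = 1 → i = 0 := by
    intro i hi
    rw [huL, ← map_one j] at hi
    exact one_add_X_zpow_eq_one hu (Units.ext (hj hi))
  let T := Matrix.toLinAlgEquiv' (R := L) (n := n)
  have hGL : IsUnit (T (j.mapMatrix G)) :=
    (((Matrix.isUnit_iff_isUnit_det G).2 hdet).map j.mapMatrix).map T
  obtain ⟨ι, hι, p, f, hsum, hp⟩ := exists_graded_projections (T (j.mapMatrix G))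
    ((Module.End.isUnit_iff _).1 hGL).1 (uL : L) uL.ne_zero htors
  obtain ⟨q, hq, hqz⟩ := exists_specialization (fun s => T.symm (p s))
    (by rw [← map_sum, hsum, map_one]) (fun x => ρ x)
  refine ⟨ι, hι, q, f, hq, fun i x hx s t hst => hqz x s t ?_⟩
  have hconst : j.mapMatrix (constMatrix k n (ρ x)) = (Algebra.ofId k L).mapMatrix (ρ x) := by
    ext r c
    exact j.commutes _
  have hconj : ((uL : L) ^ i • (Algebra.ofId k L).mapMatrix (ρ x)) * j.mapMatrix G =
      j.mapMatrix G * (Algebra.ofId k L).mapMatrix (ρ x) := by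
    rw [← hconst, ← map_mul, ← hG, map_mul, hφ i x hx, huL]
    congr 1
    ext r c
    simp [AlgHom.mapMatrix_apply]
  have h1 := hp i (T ((Algebra.ofId k L).mapMatrix (ρ x)))
    (by rw [← map_smul T, ← map_mul, ← map_mul, hconj]) s t hst
  have h2 := congrArg T.symm h1
  rwa [map_mul, map_mul, AlgEquiv.symm_apply_apply, map_zero] at h2

/-- Let `k` be an algebraically closed field, `R` a `ℤ`-graded
`k`-algebra which is finitely generated as a `k`-algebra, and `M` a finite-dimensional
`R`-module such that `Ext¹_R(M, M) = 0`, i.e. every short exact sequence of `R`-modules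
`0 → M → E → M → 0` splits.  Then `M` is gradable: it admits a `ℤ`-grading compatible
with the grading of `R`. -/
theorem gradable_of_rigid
    (k : Type u) [Field k] [IsAlgClosed k] (R : Type v) [Ring R] [Algebra k R]
    (𝒜 : ℤ → Submodule k R) [GradedAlgebra 𝒜] [Algebra.FiniteType k R]
    (M : Type v) [AddCommGroup M] [Module k M] [Module R M] [IsScalarTower k R M]
    [FiniteDimensional k M]
    (hext : ∀ (E : Type v) [AddCommGroup E] [Module R E]
      (ι : M →ₗ[R] E) (π : E →ₗ[R] M),
      Function.Injective ι → Function.Surjective π →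
      LinearMap.range ι = LinearMap.ker π →
      ∃ s : M →ₗ[R] E, π.comp s = LinearMap.id) :
    ∃ ℳ : ℤ → Submodule k M, DirectSum.IsInternal ℳ ∧
      ∀ (i j : ℤ) (x : R) (m : M), x ∈ 𝒜 i → m ∈ ℳ j → x • m ∈ ℳ (i + j) := by
  classical
  let T := LinearMap.toMatrixAlgEquiv (Module.finBasis k M)
  let α : R →ₐ[k] Module.End k M := Algebra.lsmul k k M
  obtain ⟨ι, _, q, f, hq, hqz⟩ := exists_graded_matrices 𝒜 (T.toAlgHom.comp α) (by
    intro D hD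
    obtain ⟨b, hb⟩ := exists_eq_commutator_of_rigid hext (T.symm.toLinearMap ∘ₗ D) (by
      intro x y m
      have h := congrArg T.symm (hD x y)
      rw [map_add, map_mul T.symm, map_mul T.symm] at h
      change T.symm (D (x * y)) m = _
      rw [h]
      simp [α])
    refine ⟨T b, fun x => ?_⟩
    apply T.symm.injective
    rw [map_sub, map_mul, map_mul]
    ext m
    have := hb x m
    simpa [α] using this)
  refine gradable_of_projections 𝒜 (fun s => T.symm (q s)) f (by rw [← map_sum, hq, map_one]) ?_
  intro i x hx s t hst m
  have h := congrArg T.symm (hqz i x hx s t hst)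
  rw [map_mul, map_mul, map_zero] at h
  have h' := LinearMap.congr_fun h m
  simpa [α] using h'
end
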